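/- arXiv:nlin/0205063 — 7 statements merged into one kernel-verified Lean document; each statement's English description precedes it below -/
import Mathlib

section
/- For every integer N and all y, z ∈ K, the bilinear difference equation holds: y·φ_{N+1}(y/q,z)·φ_N(y,z/q) − z·φ_{N+1}(y,z/q)·φ_N(y/q,z) = (y − z)·φ_{N+1}(y/q,z/q)·φ_N(y,z). -/
open Matrix Finset

/-- The Jacobi--Trudi type determinant: `det (p (n - 2i + j) y z)_{0 ≤ i,j ≤ n-1}`. -/
noncomputable def phiAux {K : Type*} [Field K] (p : ℤ → K → K → K) (n : ℕ) (y z : K) : K :=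
  Matrix.det (Matrix.of fun i j : Fin n => p ((n : ℤ) - 2 * ((i : ℕ) : ℤ) + ((j : ℕ) : ℤ)) y z)

/-- The polynomials `φ_N(y,z)`: for `N ≥ 0` the Jacobi--Trudi determinant (with `φ_0 = 1`
as the empty determinant), and for `N < 0` we set `φ_N = (-1)^(N(N+1)/2) φ_(-N-1)`. -/
noncomputable def phi {K : Type*} [Field K] (p : ℤ → K → K → K) (N : ℤ) (y z : K) : K :=
  if 0 ≤ N then phiAux p N.toNat y z
  else (-1 : K) ^ (N * (N + 1) / 2) * phiAux p (-N - 1).toNat y z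

section Pluecker

variable {K : Type*} [Field K]

/-- Three-term Plücker relation, for a linear functional killing all but three of `n + 3`
vectors in dimension `n + 2`. -/
theorem det_cons_pluecker {n : ℕ} (L : (Fin (n + 2) → K) →ₗ[K] K) (a b c : Fin (n + 2) → K)
    (r : Fin n → Fin (n + 2) → K) (hL : ∀ i, L (r i) = 0) :
    Matrix.det (vecCons a (vecCons c r)) * L b - Matrix.det (vecCons b (vecCons c r)) * L a
      = Matrix.det (vecCons a (vecCons b r)) * L c := by
  let w : Fin (n + 3) → Fin (n + 2) → K := vecCons a (vecCons b (vecCons c r))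
  let M : Matrix (Fin (n + 3)) (Fin (n + 3)) K := of fun i => vecCons (L (w i)) (w i)
  have hM : M.det = 0 := by
    refine Matrix.exists_mulVec_eq_zero_iff.1
      ⟨vecCons (-1) fun i => L (Pi.single i 1), fun h => ?_, ?_⟩
    · simpa using congrFun h 0
    · ext i
      have hw : L (w i) = ∑ j, w i j * L (Pi.single j 1) := by
        conv_lhs => rw [pi_eq_sum_univ' (w i)]
        simp
      simp [M, mulVec, dotProduct, Fin.sum_univ_succ (n := n + 2), hw]
  rw [det_succ_column_zero, Fin.sum_univ_succ, Fin.sum_univ_succ, Fin.sum_univ_succ] at hM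
  have h0 : M.submatrix (Fin.succAbove 0) Fin.succ = vecCons b (vecCons c r) := by
    ext i j; simp [M, w]
  have h1 : M.submatrix (Fin.succAbove (Fin.succ 0)) Fin.succ = vecCons a (vecCons c r) := by
    ext i j; refine Fin.cases ?_ (fun i => ?_) i <;> simp [M, w]
  have h2 : M.submatrix (Fin.succAbove (Fin.succ (Fin.succ 0))) Fin.succ
      = vecCons a (vecCons b r) := by
    ext i j
    refine Fin.cases ?_ (Fin.cases ?_ fun i => ?_) i <;>
      simp [M, w, -Fin.succ_zero_eq_one, -Fin.succ_one_eq_two, -Fin.succ_zero_eq_one',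
        -Fin.succ_one_eq_two']
  have hr (i : Fin n) : M i.succ.succ.succ 0 = 0 := by simp [M, w, hL]
  have m0 : M 0 0 = L a := rfl
  have m1 : M (Fin.succ 0) 0 = L b := rfl
  have m2 : M (Fin.succ (Fin.succ 0)) 0 = L c := rfl
  simp only [hr, h0, h1, h2, m0, m1, m2, Fin.val_succ, Fin.val_zero, mul_zero, zero_mul,
    Finset.sum_const_zero] at hM
  linear_combination -hM

variable {u v : K}

/-- The determinant with consecutive rows `f s, f (s + 1), …` of a sequence of vectors. -/
def windowDet {n : ℕ} (f : ℤ → Fin n → K) (s : ℤ) : K :=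
  Matrix.det (Matrix.of fun j : Fin n => f (s + ((j : ℕ) : ℤ)))

theorem windowDet_eq_det_cons {n : ℕ} {g h : ℤ → Fin (n + 1) → K}
    (hg : ∀ k, g (k + 1) = h (k + 1) + u • g k) (s : ℤ) :
    windowDet g s = Matrix.det (vecCons (g s) fun j : Fin n => h (s + 1 + ((j : ℕ) : ℤ))) := by
  refine Matrix.det_eq_of_forall_row_eq_smul_add_pred (fun _ => u) ?_ ?_
  · intro j; simp
  · intro i j
    have := congrFun (hg (s + i)) j
    simp only [of_apply, Fin.val_succ, cons_val_succ, Fin.val_castSucc]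
    push_cast
    rw [← add_assoc, this, add_right_comm]
    simp

theorem windowDet_eq_det_cons_self {n : ℕ} (h : ℤ → Fin (n + 1) → K) (s : ℤ) :
    windowDet h s = Matrix.det (vecCons (h s) fun j : Fin n => h (s + 1 + ((j : ℕ) : ℤ))) := by
  rw [windowDet]
  congr 1
  ext i j
  refine Fin.cases ?_ (fun i => ?_) i
  · simp
  · simp [add_assoc, add_comm (1 : ℤ)]

theorem det_cons_self {n : ℕ} (a : Fin (n + 2) → K) (r : Fin n → Fin (n + 2) → K) :
    Matrix.det (vecCons a (vecCons a r)) = 0 :=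
  Matrix.det_zero_of_row_eq (i := 0) (j := 1) (by simp) rfl

theorem det_cons_add {n : ℕ} (a b : Fin (n + 1) → K) (r : Fin n → Fin (n + 1) → K) :
    Matrix.det (vecCons (a + b) r) = Matrix.det (vecCons a r) + Matrix.det (vecCons b r) :=
  AlternatingMap.map_vecCons_add detRowAlternating r a b

theorem det_cons_smul {n : ℕ} (t : K) (a : Fin (n + 1) → K) (r : Fin n → Fin (n + 1) → K) :
    Matrix.det (vecCons (t • a) r) = t * Matrix.det (vecCons a r) :=
  AlternatingMap.map_vecCons_smul detRowAlternating r t a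

theorem det_cons_comm {n : ℕ} (a b : Fin (n + 2) → K) (r : Fin n → Fin (n + 2) → K) :
    Matrix.det (vecCons a (vecCons b r)) = - Matrix.det (vecCons b (vecCons a r)) := by
  refine Eq.trans (congrArg Matrix.det ?_) (AlternatingMap.map_swap detRowAlternating
    (vecCons b (vecCons a r)) (zero_ne_one : (0 : Fin (n + 2)) ≠ 1))
  ext i j
  refine Fin.cases ?_ (Fin.cases ?_ fun i => ?_) i
  · simp
  · simp
  · rw [Function.comp, Equiv.swap_apply_of_ne_of_ne (Fin.succ_ne_zero _)
      (Fin.succ_succ_ne_one i)]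
    simp

omit [Field K] in
theorem cons_window {n : ℕ} (h : ℤ → Fin (n + 2) → K) (s : ℤ) :
    (fun j : Fin (n + 1) => h (s + 1 + ((j : ℕ) : ℤ)))
      = vecCons (h (s + 1)) fun j : Fin n => h (s + 2 + ((j : ℕ) : ℤ)) := by
  ext j
  refine Fin.cases ?_ (fun i => ?_) j
  · simp
  · simp only [Fin.val_succ, cons_val_succ]
    push_cast
    rw [show s + 1 + ((i : ℤ) + 1) = s + 2 + i by ring]

theorem mul_windowDet {n : ℕ} {g h : ℤ → Fin (n + 2) → K}
    (hg : ∀ k, g (k + 1) = h (k + 1) + u • g k) (s : ℤ) :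
    u * windowDet g s = Matrix.det (vecCons (g (s + 1)) (vecCons (h (s + 1))
      fun j : Fin n => h (s + 2 + ((j : ℕ) : ℤ)))) := by
  rw [windowDet_eq_det_cons hg, cons_window, hg s, det_cons_add, det_cons_self, det_cons_smul,
    zero_add]

theorem sub_mul_windowDet {n : ℕ} {g g' h k : ℤ → Fin (n + 2) → K}
    (hg : ∀ i, g (i + 1) = h (i + 1) + u • g i)
    (hk : ∀ i, k (i + 1) = g (i + 1) + v • k i) (hk' : ∀ i, k (i + 1) = g' (i + 1) + u • k i)
    (s : ℤ) :
    (u - v) * windowDet k s = Matrix.det (vecCons (g (s + 1)) (vecCons (g' (s + 1))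
      fun j : Fin n => h (s + 2 + ((j : ℕ) : ℤ)))) := by
  have key : windowDet k s = Matrix.det (vecCons (k s) (vecCons (g (s + 1))
      fun j : Fin n => h (s + 2 + ((j : ℕ) : ℤ)))) := by
    rw [windowDet_eq_det_cons hk]
    refine Matrix.det_eq_of_forall_row_eq_smul_add_pred (Fin.cons 0 fun _ => u) (by simp) ?_
    intro i j
    refine Fin.cases ?_ (fun i => ?_) i
    · simp
    · have := congrFun (hg (s + 1 + i)) j
      simp only [Fin.val_succ, cons_val_succ, Fin.castSucc_succ, Fin.val_castSucc, Fin.cons_succ]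
      push_cast
      rw [← add_assoc, this, show s + 1 + (i : ℤ) + 1 = s + 2 + i by ring]
      rfl
  have hd : (u - v) • k s = g (s + 1) + (-1 : K) • g' (s + 1) := by
    ext j
    have h1 := congrFun (hk s) j
    have h2 := congrFun (hk' s) j
    simp only [Pi.add_apply, Pi.smul_apply, smul_eq_mul] at h1 h2 ⊢
    linear_combination h1 - h2
  rw [key, ← det_cons_smul, hd, det_cons_add, det_cons_self, det_cons_smul,
    det_cons_comm (g (s + 1))]
  ring

theorem windowDet_bilinear {n : ℕ} {g g' h k : ℤ → Fin (n + 2) → K}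
    (hg : ∀ i, g (i + 1) = h (i + 1) + u • g i) (hg' : ∀ i, g' (i + 1) = h (i + 1) + v • g' i)
    (hk : ∀ i, k (i + 1) = g (i + 1) + v • k i) (hk' : ∀ i, k (i + 1) = g' (i + 1) + u • k i)
    (s : ℤ) (L : (Fin (n + 2) → K) →ₗ[K] K)
    (hL : ∀ j : Fin n, L (h (s + 2 + ((j : ℕ) : ℤ))) = 0) :
    u * windowDet g s * L (g' (s + 1)) - v * windowDet g' s * L (g (s + 1))
      = (u - v) * windowDet k s * L (h (s + 1)) := by
  rw [mul_windowDet hg, mul_windowDet hg', sub_mul_windowDet hg hk hk']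
  exact det_cons_pluecker L _ _ _ _ hL

/-- Prepending a row is linear in that row. -/
def detConsLinear {n : ℕ} (r : Fin n → Fin (n + 1) → K) : (Fin (n + 1) → K) →ₗ[K] K where
  toFun x := Matrix.det (vecCons x r)
  map_add' a b := det_cons_add a b r
  map_smul' t a := det_cons_smul t a r

theorem detConsLinear_self {n : ℕ} (r : Fin n → Fin (n + 1) → K) (i : Fin n) :
    detConsLinear r (r i) = 0 :=
  Matrix.det_zero_of_row_eq (i := 0) (j := i.succ) (Fin.succ_ne_zero i).symm rfl

end Pluecker

section Staircase

variable {K : Type*} [Field K] {u v : K}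

/-- The staircase Jacobi--Trudi determinant of a sequence. -/
def stair (f : ℤ → K) (n : ℕ) : K :=
  Matrix.det (Matrix.of fun i j : Fin n => f ((n : ℤ) - 2 * ((i : ℕ) : ℤ) + ((j : ℕ) : ℤ)))

/-- Columns of `stair` with top entry `f (c + s)`. -/
def stairVec (f : ℤ → K) (m : ℕ) (c s : ℤ) : Fin m → K :=
  fun i => f (c + s - 2 * ((i : ℕ) : ℤ))

theorem stairVec_add_one {g h : ℤ → K} (hg : ∀ k, g k = h k + u * g (k - 1)) (m : ℕ) (c k : ℤ) :
    stairVec g m c (k + 1) = stairVec h m c (k + 1) + u • stairVec g m c k := by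
  ext i
  have := hg (c + (k + 1) - 2 * ((i : ℕ) : ℤ))
  simp only [stairVec, Pi.add_apply, Pi.smul_apply, smul_eq_mul]
  rw [this]
  congr 3
  ring

theorem stair_eq_windowDet (f : ℤ → K) (n : ℕ) (c s : ℤ) (hc : c + s = n) :
    stair f n = windowDet (stairVec f n c) s := by
  rw [stair, ← det_transpose, windowDet]
  congr 1
  ext i j
  simp only [transpose_apply, of_apply, stairVec]
  congr 1
  omega

/-- The staircase determinant is the top left minor of a determinant of size one more whose last
row is `(0, …, 0, 1)`. -/
theorem stair_eq_windowDet_succ {f : ℤ → K} (hf : ∀ k < 0, f k = 0) (hf0 : f 0 = 1) (n : ℕ) :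
    stair f n = windowDet (stairVec f (n + 1) n) 0 := by
  rw [windowDet, det_succ_column _ (Fin.last n), Fin.sum_univ_castSucc]
  have h0 (i : Fin n) : stairVec f (n + 1) n (0 + ((i.castSucc : ℕ) : ℤ)) (Fin.last n) = 0 :=
    hf _ (by simp; omega)
  have h1 : stairVec f (n + 1) n (0 + ((Fin.last n : ℕ) : ℤ)) (Fin.last n) = 1 := by
    rw [stairVec, ← hf0]; congr 1; simp; ring
  rw [stair, ← det_transpose]
  simp only [of_apply, h0, h1]
  simp only [mul_zero, zero_mul, Finset.sum_const_zero, zero_add, mul_one, ← two_mul, pow_mul,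
    neg_one_sq, one_pow, one_mul, Fin.val_last, submatrix]
  congr 1
  ext i j
  simp [stairVec]
  congr 1
  omega

theorem stair_bilinear_pos {g g' h k : ℤ → K}
    (hg : ∀ i, g i = h i + u * g (i - 1)) (hg' : ∀ i, g' i = h i + v * g' (i - 1))
    (hk : ∀ i, k i = g i + v * k (i - 1)) (hk' : ∀ i, k i = g' i + u * k (i - 1)) (n : ℕ) :
    u * stair g (n + 2) * stair g' (n + 1) - v * stair g' (n + 2) * stair g (n + 1)
      = (u - v) * stair k (n + 2) * stair h (n + 1) := by
  let c : ℤ := (n + 2 : ℕ)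
  have hc : c - 2 + (0 + 1) = (n + 1 : ℕ) := by omega
  let r : Fin n → Fin (n + 1) → K := fun j => stairVec h (n + 1) (c - 2) (0 + 1 + 1 + (j : ℕ))
  let L : (Fin (n + 2) → K) →ₗ[K] K := detConsLinear r ∘ₗ LinearMap.funLeft K K Fin.succ
  have htail (f : ℤ → K) (s : ℤ) :
      LinearMap.funLeft K K Fin.succ (stairVec f (n + 2) c s) = stairVec f (n + 1) (c - 2) s := by
    ext i
    simp only [LinearMap.funLeft_apply, stairVec, Fin.val_succ]
    congr 1; push_cast; ring
  have hL (f : ℤ → K) (s : ℤ) : L (stairVec f (n + 2) c s)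
      = Matrix.det (vecCons (stairVec f (n + 1) (c - 2) s) r) := by
    rw [← htail]; rfl
  have hLf {f : ℤ → K} {t : K} (hf : ∀ i, f i = h i + t * f (i - 1)) :
      L (stairVec f (n + 2) c (0 + 1)) = stair f (n + 1) := by
    rw [stair_eq_windowDet f (n + 1) (c - 2) (0 + 1) hc,
      windowDet_eq_det_cons (stairVec_add_one hf _ _), hL]
  have hLh : L (stairVec h (n + 2) c (0 + 1)) = stair h (n + 1) := by
    rw [stair_eq_windowDet h (n + 1) (c - 2) (0 + 1) hc, windowDet_eq_det_cons_self, hL]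
  have hw (f : ℤ → K) : stair f (n + 2) = windowDet (stairVec f (n + 2) c) 0 :=
    stair_eq_windowDet f (n + 2) c 0 (by simp [c])
  rw [hw, hw, hw, ← hLf hg, ← hLf hg', ← hLh]
  refine windowDet_bilinear (stairVec_add_one hg (n + 2) c) (stairVec_add_one hg' (n + 2) c)
    (stairVec_add_one hk (n + 2) c) (stairVec_add_one hk' (n + 2) c) 0 L fun j => ?_
  rw [hL]
  exact detConsLinear_self r j

theorem stair_bilinear_neg {g g' h k : ℤ → K}
    (hg : ∀ i, g i = h i + u * g (i - 1)) (hg' : ∀ i, g' i = h i + v * g' (i - 1))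
    (hk : ∀ i, k i = g i + v * k (i - 1)) (hk' : ∀ i, k i = g' i + u * k (i - 1))
    (hg0 : ∀ i < 0, g i = 0) (hg1 : g 0 = 1) (hg'0 : ∀ i < 0, g' i = 0) (hg'1 : g' 0 = 1)
    (hk0 : ∀ i < 0, k i = 0) (hk1 : k 0 = 1) (n : ℕ) :
    u * stair g (n + 1) * stair g' (n + 2) - v * stair g' (n + 1) * stair g (n + 2)
      = (u - v) * stair k (n + 1) * stair h (n + 2) := by
  let c : ℤ := (n + 1 : ℕ)
  have hc : c + (0 + 1) = (n + 2 : ℕ) := by omega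
  let L : (Fin (n + 2) → K) →ₗ[K] K :=
    detConsLinear fun j : Fin (n + 1) => stairVec h (n + 2) c (0 + 1 + 1 + (j : ℕ))
  have hLf {f : ℤ → K} {t : K} (hf : ∀ i, f i = h i + t * f (i - 1)) :
      stair f (n + 2) = L (stairVec f (n + 2) c (0 + 1)) := by
    rw [stair_eq_windowDet f (n + 2) c (0 + 1) hc,
      windowDet_eq_det_cons (stairVec_add_one hf _ _)]
    rfl
  have hLh : stair h (n + 2) = L (stairVec h (n + 2) c (0 + 1)) := by
    rw [stair_eq_windowDet h (n + 2) c (0 + 1) hc, windowDet_eq_det_cons_self]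
    rfl
  rw [stair_eq_windowDet_succ hg0 hg1 (n + 1), stair_eq_windowDet_succ hg'0 hg'1 (n + 1),
    stair_eq_windowDet_succ hk0 hk1 (n + 1), hLf hg, hLf hg', hLh]
  exact windowDet_bilinear (stairVec_add_one hg (n + 2) c) (stairVec_add_one hg' (n + 2) c)
    (stairVec_add_one hk (n + 2) c) (stairVec_add_one hk' (n + 2) c) 0 L
    fun j => detConsLinear_self _ j.castSucc

theorem stair_zero (f : ℤ → K) : stair f 0 = 1 := by simp [stair]

theorem stair_one (f : ℤ → K) : stair f 1 = f 1 := by simp [stair]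

end Staircase

theorem bilinear_bl341
    {K : Type*} [Field K] (q : K) (hq0 : q ≠ 0)
    (hq1 : ∀ k : ℕ, 1 ≤ k → q ^ k ≠ 1)
    (p : ℤ → K → K → K)
    (hp_neg : ∀ k : ℤ, k < 0 → ∀ y z : K, p k y z = 0)
    (hp_zero : ∀ y z : K, p 0 y z = 1)
    (hC1 : ∀ k : ℕ, 1 ≤ k → ∀ y z : K,
      (∑ i ∈ Finset.range k, q ^ i) * p (k : ℤ) y z
        = (y + z + q ^ (k - 1)) * p ((k : ℤ) - 1) y z
          - (1 - q) * y * z * p ((k : ℤ) - 2) y z)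
    (hC2 : ∀ (k : ℤ) (y z : K), p k y (q * z) - p k y z = (q - 1) * z * p (k - 1) y z)
    (hC3 : ∀ (k : ℤ) (y z : K), p k (q * y) z - p k y z = (q - 1) * y * p (k - 1) y z)
    (N : ℤ) (y z : K) :
    y * phi p (N + 1) (y / q) z * phi p N y (z / q)
      - z * phi p (N + 1) y (z / q) * phi p N (y / q) z
    = (y - z) * phi p (N + 1) (y / q) (z / q) * phi p N y z := by
  have hq : 1 - q ≠ 0 := fun h => hq1 1 le_rfl (by linear_combination -h)
  set u := (1 - q) * (y / q) with hu
  set v := (1 - q) * (z / q) with hv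
  have hy : y = q / (1 - q) * u := by rw [hu]; field_simp
  have hz : z = q / (1 - q) * v := by rw [hv]; field_simp
  have stepY (w : K) (k : ℤ) : p k (y / q) w = p k y w + u * p (k - 1) (y / q) w := by
    have := hC3 k (y / q) w
    rw [mul_div_cancel₀ _ hq0] at this
    linear_combination -this
  have stepZ (w : K) (k : ℤ) : p k w (z / q) = p k w z + v * p (k - 1) w (z / q) := by
    have := hC2 k w (z / q)
    rw [mul_div_cancel₀ _ hq0] at this
    linear_combination -this
  have neg (a b : K) : ∀ i < 0, p i a b = 0 := fun i hi => hp_neg i hi a b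
  have key {A A' B B' C D : K} (h : u * A * B' - v * A' * B = (u - v) * C * D) :
      y * A * B' - z * A' * B = (y - z) * C * D := by
    linear_combination q / (1 - q) * h + (A * B' - C * D) * hy - (A' * B - C * D) * hz
  apply key
  clear_value u v
  have one (w : K) := stepY w 1
  have one' (w : K) := stepZ w 1
  simp only [sub_self, hp_zero, mul_one] at one one'
  have hneg (m : ℕ) : ∃ t : K, ∀ a b : K,
      phi p (Int.negSucc m) a b = t * stair (fun k => p k a b) m := by
    refine ⟨(-1) ^ (Int.negSucc m * (Int.negSucc m + 1) / 2), fun a b => ?_⟩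
    rw [phi, if_neg (by omega), show (-Int.negSucc m - 1).toNat = m by omega]
    rfl
  have hpos (m : ℕ) (a b : K) : phi p m a b = stair (fun k => p k a b) m := by
    rw [phi, if_pos (by omega), Int.toNat_natCast]
    rfl
  rcases N with n | _ | n
  · rw [Int.ofNat_eq_natCast, show (n : ℤ) + 1 = (n + 1 : ℕ) from rfl]
    simp only [hpos]
    rcases n with _ | n
    · simp only [zero_add, stair_zero, stair_one, one, one']
      ring
    · exact stair_bilinear_pos (stepY z) (stepZ y) (stepZ (y / q)) (stepY (z / q)) n
  · rw [show Int.negSucc 0 + 1 = (0 : ℕ) from rfl]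
    obtain ⟨t, ht⟩ := hneg 0
    simp only [hpos, ht, stair_zero]
    ring
  · rw [show Int.negSucc (n + 1) + 1 = Int.negSucc n from rfl]
    obtain ⟨s, hs⟩ := hneg n
    obtain ⟨t, ht⟩ := hneg (n + 1)
    simp only [hs, ht]
    have core : u * stair (fun k => p k (y / q) z) n * stair (fun k => p k y (z / q)) (n + 1)
        - v * stair (fun k => p k y (z / q)) n * stair (fun k => p k (y / q) z) (n + 1)
        = (u - v) * stair (fun k => p k (y / q) (z / q)) n * stair (fun k => p k y z) (n + 1) := by
      rcases n with _ | n
      · simp only [zero_add, stair_zero, stair_one, one, one']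
        ring
      · exact stair_bilinear_neg (stepY z) (stepZ y) (stepZ (y / q)) (stepY (z / q))
          (neg _ _) (hp_zero _ _) (neg _ _) (hp_zero _ _) (neg _ _) (hp_zero _ _) n
    linear_combination s * t * core
end

section
/- For every integer N and all y, z ∈ K, the bilinear difference equation holds: y·φ_{N+1}(y,z/q)·φ_N(y/q,z) − z·φ_{N+1}(y/q,z)·φ_N(y,z/q) = (y − z)·φ_{N+1}(y,z)·φ_N(y/q,z/q). -/
open Matrix Finset

section BorderedDeterminants

variable {R : Type*} [CommRing R]

/-- The three-term Plücker relation for determinants sharing all rows but two. -/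
theorem det_vecCons_plucker {n : ℕ} (M : Fin n → Fin (n + 2) → R) (u v w x : Fin (n + 2) → R) :
    det (of (vecCons u (vecCons v M))) * det (of (vecCons w (vecCons x M)))
      = det (of (vecCons w (vecCons v M))) * det (of (vecCons u (vecCons x M)))
        + det (of (vecCons u (vecCons w M))) * det (of (vecCons v (vecCons x M))) := by
  set A : Matrix (Fin (n + 2)) (Fin (n + 2)) R := of (vecCons u (vecCons v M)) with hA
  set B : Matrix (Fin (n + 2)) (Fin (n + 2)) R := of (vecCons 0 (vecCons x M)) with hB
  have hBt (t) : cramer Bᵀ t 0 = det (of (vecCons t (vecCons x M))) := by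
    rw [cramer_transpose_apply]
    congr 1
    ext i j
    refine Fin.cases ?_ (fun i => ?_) i <;> simp [hB, updateRow_apply, Fin.succ_ne_zero]
  have hA0 : cramer Aᵀ w 0 = det (of (vecCons w (vecCons v M))) := by
    rw [cramer_transpose_apply]
    congr 1
    ext i j
    refine Fin.cases ?_ (fun i => ?_) i <;> simp [hA, updateRow_apply, Fin.succ_ne_zero]
  have hA1 : cramer Aᵀ w 1 = det (of (vecCons u (vecCons w M))) := by
    rw [cramer_transpose_apply]
    congr 1
    ext i j
    refine Fin.cases ?_ (Fin.cases ?_ fun i => ?_) i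
    · simp [hA, updateRow_apply]
    · simp [hA, updateRow_apply]
    · simp [hA, updateRow_apply, ← Fin.succ_zero_eq_one, Fin.succ_ne_zero, -Fin.succ_zero_eq_one']
  have hzero (i : Fin n) : cramer Bᵀ (M i) 0 = 0 := by
    rw [hBt]
    exact det_zero_of_row_eq (i := 0) (j := i.succ.succ) (Fin.succ_ne_zero _).symm (by ext; simp)
  have key := congrArg (fun t => cramer Bᵀ t 0) (mulVec_cramer Aᵀ w)
  simp only [mulVec_eq_sum, map_sum, Finset.sum_apply, map_smul, Pi.smul_apply, op_smul_eq_smul,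
    smul_eq_mul, det_transpose, transpose_transpose] at key
  simp only [Fin.sum_univ_succ] at key
  have r0 : A 0 = u := rfl
  have r2 (i : Fin n) : A i.succ.succ = M i := rfl
  simp only [r0, r2, hzero, mul_zero, Finset.sum_const_zero, add_zero, hBt, hA0,
    Fin.succ_zero_eq_one, hA1] at key
  exact key.symm

theorem det_vecCons_swap {n : ℕ} (M : Fin n → Fin (n + 2) → R) (u v : Fin (n + 2) → R) :
    det (of (vecCons u (vecCons v M))) = -det (of (vecCons v (vecCons u M))) := by
  have e : vecCons u (vecCons v M) = vecCons v (vecCons u M) ∘ Equiv.swap 0 1 := by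
    funext i
    refine Fin.cases ?_ (Fin.cases ?_ fun i => ?_) i
    · simp
    · simp
    · rw [Function.comp_apply, Equiv.swap_apply_of_ne_of_ne (Fin.succ_ne_zero _)
        (by simp [← Fin.succ_zero_eq_one, Fin.succ_ne_zero, -Fin.succ_zero_eq_one'])]
      simp
  rw [e]
  exact (detRowAlternating : (Fin (n + 2) → R) [⋀^Fin (n + 2)]→ₗ[R] R).map_swap
    (vecCons v (vecCons u M)) zero_ne_one

/-- A determinant with first row `(1, 0, …, 0)`. -/
theorem det_vecCons_single_zero {n : ℕ} (M : Fin n → Fin (n + 1) → R) :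
    det (of (vecCons (Pi.single 0 1) M)) = det (of fun i j : Fin n => M i j.succ) := by
  rw [det_succ_row_zero, Fin.sum_univ_succ]
  simp [submatrix]

/-- A determinant with first row `(0, …, 0, 1)`. -/
theorem det_vecCons_single_last {n : ℕ} (M : Fin n → Fin (n + 1) → R) :
    det (of (vecCons (Pi.single (Fin.last n) 1) M))
      = (-1) ^ n * det (of fun i j : Fin n => M i j.castSucc) := by
  rw [det_succ_row_zero, Fin.sum_univ_castSucc]
  simp [submatrix]

/-- A determinant with last row `(0, …, 0, 1)`. -/
theorem det_of_last_row_eq_single {n : ℕ} (M : Fin (n + 1) → Fin (n + 1) → R)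
    (hM : M (Fin.last n) = Pi.single (Fin.last n) 1) :
    det (of M) = det (of fun i j : Fin n => M i.castSucc j.castSucc) := by
  rw [det_succ_row _ (Fin.last n), Fin.sum_univ_castSucc]
  simp [submatrix, hM]

/-- A determinant bordered by the row of powers of `a`. -/
theorem det_vecCons_pow {n : ℕ} (a : R) (M : Fin n → Fin (n + 1) → R) :
    det (of (vecCons (fun j => a ^ (j : ℕ)) M))
      = det (of fun i j : Fin n => M i j.succ - a * M i j.castSucc) := by
  have h := det_vecCons_single_zero fun i =>
    (Fin.cons (M i 0) fun j => M i j.succ - a * M i j.castSucc : Fin (n + 1) → R)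
  simp only [Fin.cons_succ] at h
  rw [← h]
  refine det_eq_of_forall_col_eq_smul_add_pred (fun _ => a) (fun i => ?_) fun i j => ?_
  · refine Fin.cases ?_ (fun i => ?_) i <;> simp
  · refine Fin.cases ?_ (fun i => ?_) i
    · simp [pow_succ']
    · simp

/-- Multiplication of the generating function of `h` by `1 - a t`. -/
def shiftSub (a : R) (h : ℤ → R) (k : ℤ) : R := h k - a * h (k - 1)

theorem det_single_zero_shift {n : ℕ} (h : ℤ → R) (s : Fin n → ℤ) :
    det (of (vecCons (Pi.single 0 1) fun i (j : Fin (n + 1)) => h (s i + (j : ℕ))))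
      = det (of fun i j : Fin n => h (s i + 1 + (j : ℕ))) := by
  rw [det_vecCons_single_zero]
  congr! 5
  push_cast [Fin.val_succ]
  ring

theorem det_pow_shift {n : ℕ} (a : R) (h : ℤ → R) (s : Fin n → ℤ) :
    det (of (vecCons (fun j => a ^ (j : ℕ)) fun i (j : Fin (n + 1)) => h (s i + (j : ℕ))))
      = det (of fun i j : Fin n => shiftSub a h (s i + 1 + (j : ℕ))) := by
  rw [det_vecCons_pow]
  congr 2
  ext i j
  have e1 : s i + ((j.succ : ℕ) : ℤ) = s i + 1 + (j : ℕ) := by push_cast [Fin.val_succ]; ring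
  have e2 : s i + ((j.castSucc : ℕ) : ℤ) = s i + 1 + (j : ℕ) - 1 := by simp; ring
  rw [shiftSub, e1, e2]

theorem det_vecCons_smul {n : ℕ} (c : R) (u : Fin (n + 1) → R) (M : Fin n → Fin (n + 1) → R) :
    det (of (vecCons (fun j => c * u j) M)) = c * det (of (vecCons u M)) := by
  rw [det_succ_row_zero, det_succ_row_zero, Finset.mul_sum]
  refine Finset.sum_congr rfl fun j _ => ?_
  simp only [of_apply, cons_val_zero]
  have e (v : Fin (n + 1) → R) : (of (vecCons v M)).submatrix Fin.succ j.succAbove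
      = of fun i k => M i (j.succAbove k) := by
    ext; simp
  rw [e, e]
  ring

theorem det_pow_pow_shift {n : ℕ} (a b : R) (h : ℤ → R) (s : Fin n → ℤ) :
    det (of (vecCons (fun j => a ^ (j : ℕ)) (vecCons (fun j => b ^ (j : ℕ))
        fun i (j : Fin (n + 2)) => h (s i + (j : ℕ)))))
      = (b - a) * det (of fun i j : Fin n => shiftSub b (shiftSub a h) (s i + 2 + (j : ℕ))) := by
  rw [det_vecCons_pow]
  have e : (fun i j : Fin (n + 1) =>
      vecCons (fun j : Fin (n + 2) => b ^ (j : ℕ)) (fun i j => h (s i + (j : ℕ))) i j.succ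
        - a * vecCons (fun j : Fin (n + 2) => b ^ (j : ℕ)) (fun i j => h (s i + (j : ℕ))) i
          j.castSucc)
      = vecCons (fun j : Fin (n + 1) => (b - a) * b ^ (j : ℕ))
        fun i j => shiftSub a h (s i + 1 + (j : ℕ)) := by
    ext i j
    refine Fin.cases ?_ (fun i => ?_) i
    · simp; ring
    · have e1 : s i + ((j : ℤ) + 1) = s i + 1 + (j : ℕ) := by ring
      have e2 : s i + (j : ℤ) = s i + 1 + (j : ℕ) - 1 := by ring
      simp [shiftSub, e1]
      simp [e2]
  rw [e, det_vecCons_smul, det_pow_shift]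
  congr! 6
  ring

theorem det_single_zero_pow_shift {n : ℕ} (a : R) (h : ℤ → R) (s : Fin n → ℤ) :
    det (of (vecCons (Pi.single 0 1) (vecCons (fun j => a ^ (j : ℕ))
        fun i (j : Fin (n + 2)) => h (s i + (j : ℕ)))))
      = a * det (of fun i j : Fin n => shiftSub a h (s i + 2 + (j : ℕ))) := by
  rw [det_vecCons_single_zero]
  have e : (fun i j : Fin (n + 1) =>
      vecCons (fun j : Fin (n + 2) => a ^ (j : ℕ)) (fun i j => h (s i + (j : ℕ))) i j.succ)
      = vecCons (fun j : Fin (n + 1) => a * a ^ (j : ℕ)) fun i j => h (s i + 1 + (j : ℕ)) := by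
    ext i j
    refine Fin.cases ?_ (fun i => ?_) i
    · simp [pow_succ']
    · have e1 : s i + ((j : ℤ) + 1) = s i + 1 + (j : ℕ) := by ring
      simp [e1]
  rw [e, det_vecCons_smul, det_pow_shift]
  congr! 6
  ring

theorem det_single_last_vecCons {n : ℕ} (u : Fin (n + 2) → R) (M : Fin n → Fin (n + 2) → R) :
    det (of (vecCons (Pi.single (Fin.last _) 1) (vecCons u M)))
      = (-1) ^ (n + 1) * det (of (vecCons (fun j => u j.castSucc) fun i j => M i j.castSucc)) := by
  rw [det_vecCons_single_last]
  congr 3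
  ext i j
  refine Fin.cases ?_ (fun i => ?_) i <;> simp

theorem det_single_last_pow_shift {n : ℕ} (a : R) (h : ℤ → R) (s : Fin n → ℤ) :
    det (of (vecCons (Pi.single (Fin.last _) 1) (vecCons (fun j => a ^ (j : ℕ))
        fun i (j : Fin (n + 2)) => h (s i + (j : ℕ)))))
      = (-1) ^ (n + 1) * det (of fun i j : Fin n => shiftSub a h (s i + 1 + (j : ℕ))) := by
  rw [det_single_last_vecCons, ← det_pow_shift]
  rfl

theorem det_single_last_single_zero_shift {n : ℕ} (h : ℤ → R) (s : Fin n → ℤ) :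
    det (of (vecCons (Pi.single (Fin.last _) 1) (vecCons (Pi.single 0 1)
        fun i (j : Fin (n + 2)) => h (s i + (j : ℕ)))))
      = (-1) ^ (n + 1) * det (of fun i j : Fin n => h (s i + 1 + (j : ℕ))) := by
  rw [det_single_last_vecCons, ← det_single_zero_shift]
  have e : (fun j : Fin (n + 1) => (Pi.single 0 1 : Fin (n + 2) → R) j.castSucc)
      = Pi.single 0 1 := by
    ext j
    simp only [Pi.single_apply, Fin.castSucc_eq_zero_iff]
  rw [e]
  rfl

end BorderedDeterminants

section Staircase

variable {R : Type*} [CommRing R]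

/-- The Jacobi--Trudi determinant of the staircase partition `(n, n - 1, …, 1)`. -/
def staircaseDet (n : ℕ) (h : ℤ → R) : R :=
  det (of fun i j : Fin n => h ((n : ℤ) - 2 * ((i : ℕ) : ℤ) + ((j : ℕ) : ℤ)))

/-- A zero part may be appended to the staircase without changing the determinant. -/
theorem det_staircase_append_zero (n : ℕ) {h : ℤ → R} (hneg : ∀ k < 0, h k = 0) (hzero : h 0 = 1) :
    det (of fun i j : Fin (n + 1) => h ((n : ℤ) - 2 * ((i : ℕ) : ℤ) + ((j : ℕ) : ℤ)))
      = staircaseDet n h := by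
  rw [det_of_last_row_eq_single]
  · rfl
  · ext j
    refine Fin.lastCases ?_ (fun j => ?_) j
    · rw [← hzero]
      simp only [Fin.val_last, Pi.single_eq_same, hzero]
      rw [← hzero]
      congr 1
      ring
    · rw [Pi.single_eq_of_ne (Fin.castSucc_ne_last j)]
      apply hneg
      have := j.2
      simp
      omega

theorem shiftSub_of_neg (a : R) {h : ℤ → R} (hneg : ∀ k < 0, h k = 0) (k : ℤ) (hk : k < 0) :
    shiftSub a h k = 0 := by
  simp [shiftSub, hneg k hk, hneg (k - 1) (by lia)]

theorem shiftSub_zero (a : R) {h : ℤ → R} (hneg : ∀ k < 0, h k = 0) (hzero : h 0 = 1) :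
    shiftSub a h 0 = 1 := by
  simp [shiftSub, hzero, hneg (-1) (by lia)]

/-- The bilinear relation between staircase determinants of lengths `n + 1` and `n`. -/
theorem staircaseDet_bilinear (n : ℕ) (a b : R) {h : ℤ → R} (hneg : ∀ k < 0, h k = 0)
    (hzero : h 0 = 1) :
    a * staircaseDet (n + 1) (shiftSub a h) * staircaseDet n (shiftSub b h)
      - b * staircaseDet (n + 1) (shiftSub b h) * staircaseDet n (shiftSub a h)
    = (a - b) * staircaseDet (n + 1) (shiftSub b (shiftSub a h)) * staircaseDet n h := by
  set s : Fin (n + 1) → ℤ := fun i => (n : ℤ) - 1 - 2 * ((i : ℕ) : ℤ) with hs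
  have s1 (i j : Fin (n + 1)) :
      s i + 1 + (j : ℕ) = (n : ℤ) - 2 * ((i : ℕ) : ℤ) + ((j : ℕ) : ℤ) := by simp only [hs]; ring
  have s2 (i j : Fin (n + 1)) :
      s i + 2 + (j : ℕ) = ((n + 1 : ℕ) : ℤ) - 2 * ((i : ℕ) : ℤ) + ((j : ℕ) : ℤ) := by
    simp only [hs]; push_cast; ring
  have key := det_vecCons_plucker (fun i (j : Fin (n + 1 + 2)) => h (s i + (j : ℕ)))
    (fun j => a ^ (j : ℕ)) (fun j => b ^ (j : ℕ)) (Pi.single (Fin.last _) 1) (Pi.single 0 1)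
  rw [det_vecCons_swap _ (fun j : Fin (n + 1 + 2) => a ^ (j : ℕ)) (Pi.single 0 1),
    det_vecCons_swap _ (fun j : Fin (n + 1 + 2) => b ^ (j : ℕ)) (Pi.single 0 1),
    det_vecCons_swap _ _ (Pi.single (Fin.last _) 1)] at key
  simp only [det_pow_pow_shift, det_single_zero_pow_shift, det_single_last_pow_shift,
    det_single_last_single_zero_shift, s1, s2,
    det_staircase_append_zero n hneg hzero,
    det_staircase_append_zero n (shiftSub_of_neg _ hneg) (shiftSub_zero _ hneg hzero)] at key
  simp only [← staircaseDet.eq_1] at key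
  refine (isUnit_neg_one.pow (n + 1 + 1)).mul_left_cancel ?_
  linear_combination key

/-- The bilinear relation with the roles of the two staircase lengths exchanged. -/
theorem staircaseDet_bilinear_swap (n : ℕ) (a b : R) (h : ℤ → R) :
    a * staircaseDet n (shiftSub a h) * staircaseDet (n + 1) (shiftSub b h)
      - b * staircaseDet n (shiftSub b h) * staircaseDet (n + 1) (shiftSub a h)
    = (a - b) * staircaseDet n (shiftSub b (shiftSub a h)) * staircaseDet (n + 1) h := by
  set s : Fin n → ℤ := fun i => (n : ℤ) - 2 - 2 * ((i : ℕ) : ℤ) with hs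
  set t : Fin (n + 1) → ℤ := fun i => (n : ℤ) - 2 * ((i : ℕ) : ℤ) with ht
  have s2 (i j : Fin n) :
      s i + 2 + (j : ℕ) = (n : ℤ) - 2 * ((i : ℕ) : ℤ) + ((j : ℕ) : ℤ) := by
    simp only [hs]; ring
  have t1 (i j : Fin (n + 1)) :
      t i + 1 + (j : ℕ) = ((n + 1 : ℕ) : ℤ) - 2 * ((i : ℕ) : ℤ) + ((j : ℕ) : ℤ) := by
    simp only [ht]; push_cast; ring
  have cons_rows : vecCons (fun j : Fin (n + 2) => h ((n : ℤ) + (j : ℕ)))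
      (fun i (j : Fin (n + 2)) => h (s i + (j : ℕ))) =
      fun i (j : Fin (n + 2)) => h (t i + (j : ℕ)) := by
    ext i j
    refine Fin.cases ?_ (fun i => ?_) i
    · simp [ht]
    · simp only [cons_val_succ, hs, ht, Fin.val_succ]
      congr 1
      push_cast
      ring
  have key := det_vecCons_plucker (fun i (j : Fin (n + 2)) => h (s i + (j : ℕ)))
    (fun j => a ^ (j : ℕ)) (fun j => b ^ (j : ℕ)) (fun j => h ((n : ℤ) + (j : ℕ))) (Pi.single 0 1)
  rw [det_vecCons_swap _ (fun j : Fin (n + 2) => a ^ (j : ℕ)) (Pi.single 0 1),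
    det_vecCons_swap _ (fun j : Fin (n + 2) => b ^ (j : ℕ)) (Pi.single 0 1),
    det_vecCons_swap _ (fun j : Fin (n + 2) => h ((n : ℤ) + (j : ℕ))) (Pi.single 0 1),
    det_vecCons_swap _ (fun j : Fin (n + 2) => h ((n : ℤ) + (j : ℕ)))] at key
  simp only [cons_rows, det_pow_pow_shift, det_single_zero_pow_shift, det_pow_shift,
    det_single_zero_shift, s2, t1] at key
  simp only [← staircaseDet.eq_1] at key
  linear_combination -key

end Staircase

theorem phiAux_eq_staircaseDet {K : Type*} [Field K] (p : ℤ → K → K → K) (n : ℕ) (y z : K) :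
    phiAux p n y z = staircaseDet n fun k => p k y z := rfl

/-- Up to factors independent of the variables, `φ_N` and `φ_{N+1}` are staircase determinants of
consecutive lengths, or both constant. -/
theorem exists_phi_pair {K : Type*} [Field K] (p : ℤ → K → K → K) (N : ℤ) :
    ∃ (c d : K) (n : ℕ),
      (∀ y z, phi p N y z = c * phiAux p n y z ∧ phi p (N + 1) y z = d * phiAux p (n + 1) y z) ∨
      (∀ y z, phi p N y z = c * phiAux p (n + 1) y z ∧ phi p (N + 1) y z = d * phiAux p n y z) ∨
      (∀ y z, phi p N y z = c ∧ phi p (N + 1) y z = d) := by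
  rcases lt_trichotomy N (-1) with hN | rfl | hN
  · refine ⟨(-1) ^ (N * (N + 1) / 2), (-1) ^ ((N + 1) * (N + 1 + 1) / 2), (-N - 2).toNat,
      Or.inr (Or.inl fun y z => ⟨?_, ?_⟩)⟩
    · rw [phi, if_neg (by lia), show (-N - 1).toNat = (-N - 2).toNat + 1 by lia]
    · rw [phi, if_neg (by lia), show (-(N + 1) - 1).toNat = (-N - 2).toNat by lia]
  · exact ⟨1, 1, 0, Or.inr (Or.inr fun y z => by simp [phi, phiAux])⟩
  · refine ⟨1, 1, N.toNat, Or.inl fun y z => ⟨?_, ?_⟩⟩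
    · rw [phi, if_pos (by lia), one_mul]
    · rw [phi, if_pos (by lia), show (N + 1).toNat = N.toNat + 1 by lia, one_mul]

theorem bilinear_bl342
    {K : Type*} [Field K] (q : K) (hq0 : q ≠ 0)
    (hq1 : ∀ k : ℕ, 1 ≤ k → q ^ k ≠ 1)
    (p : ℤ → K → K → K)
    (hp_neg : ∀ k : ℤ, k < 0 → ∀ y z : K, p k y z = 0)
    (hp_zero : ∀ y z : K, p 0 y z = 1)
    (hC1 : ∀ k : ℕ, 1 ≤ k → ∀ y z : K,
      (∑ i ∈ Finset.range k, q ^ i) * p (k : ℤ) y z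
        = (y + z + q ^ (k - 1)) * p ((k : ℤ) - 1) y z
          - (1 - q) * y * z * p ((k : ℤ) - 2) y z)
    (hC2 : ∀ (k : ℤ) (y z : K), p k y (q * z) - p k y z = (q - 1) * z * p (k - 1) y z)
    (hC3 : ∀ (k : ℤ) (y z : K), p k (q * y) z - p k y z = (q - 1) * y * p (k - 1) y z)
    (N : ℤ) (y z : K) :
    y * phi p (N + 1) y (z / q) * phi p N (y / q) z
      - z * phi p (N + 1) (y / q) z * phi p N y (z / q)
    = (y - z) * phi p (N + 1) y z * phi p N (y / q) (z / q) := by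
  set h : ℤ → K := fun k => p k (y / q) (z / q) with hh
  set a : K := (1 - q) / q * y with ha
  set b : K := (1 - q) / q * z with hb
  have hq : (1 - q) / q ≠ 0 :=
    div_ne_zero (sub_ne_zero.2 fun e => hq1 1 le_rfl (by rw [pow_one, ← e])) hq0
  have step_y (z : K) : (fun k => p k y z) = shiftSub a fun k => p k (y / q) z := by
    ext k
    have e := hC3 k (y / q) z
    rw [mul_div_cancel₀ _ hq0] at e
    rw [shiftSub, ha]
    linear_combination e
  have step_z (y : K) : (fun k => p k y z) = shiftSub b fun k => p k y (z / q) := by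
    ext k
    have e := hC2 k y (z / q)
    rw [mul_div_cancel₀ _ hq0] at e
    rw [shiftSub, hb]
    linear_combination e
  have py : (fun k => p k y (z / q)) = shiftSub a h := step_y _
  have pz : (fun k => p k (y / q) z) = shiftSub b h := step_z _
  have pyz : (fun k => p k y z) = shiftSub b (shiftSub a h) := by rw [step_z, py]
  obtain ⟨c, d, n, H | H | H⟩ := exists_phi_pair p N
  · simp only [(H _ _).1, (H _ _).2, phiAux_eq_staircaseDet, py, pz, pyz]
    have key := staircaseDet_bilinear n a b (h := h) (fun k hk => hp_neg k hk _ _) (hp_zero _ _)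
    refine mul_left_cancel₀ hq ?_
    linear_combination c * d * key
  · simp only [(H _ _).1, (H _ _).2, phiAux_eq_staircaseDet, py, pz, pyz]
    have key := staircaseDet_bilinear_swap n a b h
    refine mul_left_cancel₀ hq ?_
    linear_combination c * d * key
  · simp only [(H _ _).1, (H _ _).2]
    ring
end

section
/- For every integer N and all y, z ∈ K, the bilinear difference equation holds: φ_{N+1}(y,z/q)·φ_{N−1}(y,z) − φ_{N+1}(y,z)·φ_{N−1}(y,z/q) = (1 − q)·(z/q)·φ_N(y,z/q)·φ_N(y,z). -/
open Matrix Finset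

namespace Matrix

/-- Jacobi's complementary minor theorem for a `2 × 2` block of the adjugate, before cancelling
one factor of the determinant. -/
theorem det_mul_det_adjugate_toBlocks₂₂ {m l R : Type*} [Fintype m] [Fintype l] [DecidableEq m]
    [DecidableEq l] [CommRing R] (A : Matrix (m ⊕ l) (m ⊕ l) R) :
    A.det * A.adjugate.toBlocks₂₂.det = A.toBlocks₁₁.det * A.det ^ Fintype.card l := by
  have h : A * fromBlocks 1 A.adjugate.toBlocks₁₂ 0 A.adjugate.toBlocks₂₂
      = fromBlocks A.toBlocks₁₁ 0 A.toBlocks₂₁ (A.det • 1) := by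
    have hadj := mul_adjugate A
    rw [← fromBlocks_toBlocks A, ← fromBlocks_toBlocks (adjugate (fromBlocks _ _ _ _)),
      fromBlocks_multiply, ← fromBlocks_one, fromBlocks_smul, fromBlocks_inj] at hadj
    obtain ⟨-, h₁₂, -, h₂₂⟩ := hadj
    rw [fromBlocks_toBlocks] at h₁₂ h₂₂
    conv_lhs => rw [← fromBlocks_toBlocks A]
    rw [fromBlocks_multiply, fromBlocks_toBlocks, h₁₂, h₂₂]
    simp
  have hdet := congrArg det h
  rwa [det_mul, det_fromBlocks_zero₂₁, det_fromBlocks_zero₁₂, det_one, one_mul, det_smul,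
    det_one, mul_one] at hdet

theorem det_adjugate_toBlocks₂₂_of_fin_two {m R : Type*} [Fintype m] [DecidableEq m]
    [CommRing R] (A : Matrix (m ⊕ Fin 2) (m ⊕ Fin 2) R) :
    A.adjugate.toBlocks₂₂.det = A.det * A.toBlocks₁₁.det := by
  let A' := mvPolynomialX (m ⊕ Fin 2) (m ⊕ Fin 2) ℤ
  have h : A'.adjugate.toBlocks₂₂.det = A'.det * A'.toBlocks₁₁.det := by
    apply mul_left_cancel₀ (show A'.det ≠ 0 from det_mvPolynomialX_ne_zero _ ℤ)
    rw [det_mul_det_adjugate_toBlocks₂₂, Fintype.card_fin]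
    ring
  let f : MvPolynomial ((m ⊕ Fin 2) × (m ⊕ Fin 2)) ℤ →ₐ[ℤ] R :=
    MvPolynomial.aeval fun ij => A ij.1 ij.2
  have hA : f.mapMatrix A' = A := mvPolynomialX_mapMatrix_aeval ℤ A
  have h' := congrArg f h
  rw [map_mul, AlgHom.map_det, AlgHom.map_det, AlgHom.map_det, hA] at h'
  have h₁ : f.mapMatrix A'.adjugate.toBlocks₂₂ = A.adjugate.toBlocks₂₂ := by
    rw [← hA, ← AlgHom.map_adjugate]
    rfl
  have h₂ : f.mapMatrix A'.toBlocks₁₁ = A.toBlocks₁₁ := by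
    rw [← hA]
    rfl
  rwa [h₁, h₂] at h'

/-- The Desnanot–Jacobi identity. -/
theorem det_mul_det_submatrix_inner {n : ℕ} {R : Type*} [CommRing R]
    (A : Matrix (Fin (n + 2)) (Fin (n + 2)) R) :
    A.det * (A.submatrix (fun i : Fin n => i.castSucc.succ) (fun i => i.castSucc.succ)).det
      = (A.submatrix Fin.succ Fin.succ).det * (A.submatrix Fin.castSucc Fin.castSucc).det
        - (A.submatrix Fin.succ Fin.castSucc).det * (A.submatrix Fin.castSucc Fin.succ).det := by
  let g : Fin n ⊕ Fin 2 → Fin (n + 2) :=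
    Sum.elim (fun i => i.castSucc.succ) ![0, Fin.last (n + 1)]
  have hg : Function.Bijective g := by
    rw [Fintype.bijective_iff_injective_and_card]
    refine ⟨?_, by simp⟩
    rintro (i | i) (j | j) h
    · simpa [g] using h
    · fin_cases j
      · simp [g, Fin.ext_iff] at h
      · simp [g, Fin.ext_iff] at h; omega
    · fin_cases i
      · simp [g, Fin.ext_iff] at h
      · simp [g, Fin.ext_iff] at h; omega
    · fin_cases i <;> fin_cases j <;> simp [g, Fin.ext_iff] at h ⊢
  let e := Equiv.ofBijective g hg
  have h := det_adjugate_toBlocks₂₂_of_fin_two (A.submatrix e e)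
  rw [adjugate_submatrix_equiv_self, det_submatrix_equiv_self, det_fin_two] at h
  have h₁₁ : (A.submatrix e e).toBlocks₁₁
      = A.submatrix (fun i : Fin n => i.castSucc.succ) (fun i => i.castSucc.succ) := rfl
  rw [h₁₁] at h
  rw [← h]
  change A.adjugate 0 0 * A.adjugate (Fin.last _) (Fin.last _)
    - A.adjugate 0 (Fin.last _) * A.adjugate (Fin.last _) 0 = _
  simp only [adjugate_fin_succ_eq_det_submatrix, Fin.succAbove_zero, Fin.succAbove_last,
    Fin.val_zero, Fin.val_last, zero_add, add_zero, pow_zero, one_mul]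
  rw [← two_mul, pow_mul, neg_one_sq, one_pow, one_mul]
  have hs : ((-1 : R) ^ (n + 1)) * (-1) ^ (n + 1) = 1 := by
    rw [← mul_pow]
    simp
  linear_combination (-(A.submatrix Fin.castSucc Fin.succ).det
    * (A.submatrix Fin.succ Fin.castSucc).det) * hs

theorem det_succ_of_last_row {n : ℕ} {R : Type*} [CommRing R]
    (A : Matrix (Fin (n + 1)) (Fin (n + 1)) R) (k : Fin (n + 1))
    (h : ∀ j, j ≠ k → A (Fin.last n) j = 0) :
    A.det = (-1) ^ (n + (k : ℕ)) * A (Fin.last n) k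
      * (A.submatrix Fin.castSucc k.succAbove).det := by
  rw [det_succ_row A (Fin.last n), Fintype.sum_eq_single k fun j hj => by rw [h j hj]; simp]
  rw [Fin.succAbove_last, Fin.val_last]

end Matrix

/-- The matrix with entries `f (m - 2 i + j)`. -/
def stepTwoToeplitz {R : Type*} (f : ℤ → R) (m : ℤ) (n : ℕ) : Matrix (Fin n) (Fin n) R :=
  Matrix.of fun i j => f (m - 2 * ((i : ℕ) : ℤ) + ((j : ℕ) : ℤ))

theorem phiAux_eq_det_stepTwoToeplitz {K : Type*} [Field K] (p : ℤ → K → K → K) (n : ℕ) (y z : K) :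
    phiAux p n y z = (stepTwoToeplitz (fun k => p k y z) n n).det :=
  rfl

theorem det_stepTwoToeplitz_succ {R : Type*} [CommRing R] (f : ℤ → R) (hneg : ∀ k < 0, f k = 0)
    (hzero : f 0 = 1) (n : ℕ) :
    (stepTwoToeplitz f n (n + 1)).det = (stepTwoToeplitz f n n).det := by
  rw [Matrix.det_succ_of_last_row _ (Fin.last n)]
  · rw [Fin.succAbove_last, Fin.val_last, ← two_mul, pow_mul, neg_one_sq, one_pow, one_mul]
    have : stepTwoToeplitz f n (n + 1) (Fin.last n) (Fin.last n) = 1 := by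
      rw [← hzero]
      simp only [stepTwoToeplitz, Matrix.of_apply, Fin.val_last]
      congr 1
      ring
    rw [this, one_mul]
    rfl
  · intro j hj
    have hlt := Fin.val_lt_last hj
    refine hneg _ ?_
    simp only [Fin.val_last]
    omega

/-- Bordering by a geometric row replaces `f k` by `f k - c * f (k - 1)`. -/
theorem det_of_geometric_last_row {R : Type*} [CommRing R] (f : ℤ → R) (c s : R) (m : ℤ) (n : ℕ) :
    (Matrix.of fun i j : Fin (n + 1) => if (i : ℕ) < n
        then f (m - 2 * ((i : ℕ) : ℤ) + ((j : ℕ) : ℤ)) else s * c ^ (j : ℕ)).det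
      = (-1) ^ n * s * (stepTwoToeplitz (fun k => f k - c * f (k - 1)) (m + 1) n).det := by
  rw [Matrix.det_eq_of_forall_col_eq_smul_add_pred
    (B := Matrix.of fun i j : Fin (n + 1) => if (i : ℕ) < n
      then (if (j : ℕ) = 0 then f (m - 2 * ((i : ℕ) : ℤ))
        else f (m - 2 * ((i : ℕ) : ℤ) + ((j : ℕ) : ℤ))
          - c * f (m - 2 * ((i : ℕ) : ℤ) + ((j : ℕ) : ℤ) - 1))
      else if (j : ℕ) = 0 then s else 0) (fun _ => c)]
  · rw [Matrix.det_succ_of_last_row _ 0]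
    · simp only [Matrix.of_apply, Fin.val_last, lt_irrefl, if_false, Fin.val_zero, add_zero,
        if_true]
      congr 2
      ext i j
      simp only [Matrix.submatrix_apply, Matrix.of_apply, Fin.val_castSucc, i.isLt, if_true,
        Fin.succAbove_zero, Fin.val_succ, stepTwoToeplitz, Nat.succ_ne_zero, if_false]
      push_cast
      ring_nf
    · intro j hj
      simp [hj]
  · intro i
    simp
  · intro i j
    by_cases hi : (i : ℕ) < n
    · simp only [Matrix.of_apply, hi, if_true, Fin.val_succ, Nat.succ_ne_zero, if_false,
        Fin.val_castSucc]
      push_cast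
      ring_nf
    · simp only [Matrix.of_apply, hi, if_false, Fin.val_succ, Nat.succ_ne_zero, Fin.val_castSucc]
      ring

/-- The bilinear relation between the staircase determinants of `f` and of `f k - c * f (k - 1)`. -/
theorem stepTwoToeplitz_bilinear {R : Type*} [CommRing R] (f g : ℤ → R) (c : R)
    (hf_neg : ∀ k < 0, f k = 0) (hf_zero : f 0 = 1) (hg : ∀ k, g k = f k - c * f (k - 1))
    (n : ℕ) :
    (stepTwoToeplitz f (n + 2 : ℕ) (n + 2)).det * (stepTwoToeplitz g n n).det
      - (stepTwoToeplitz g (n + 2 : ℕ) (n + 2)).det * (stepTwoToeplitz f n n).det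
    = c * (stepTwoToeplitz f (n + 1 : ℕ) (n + 1)).det
      * (stepTwoToeplitz g (n + 1 : ℕ) (n + 1)).det := by
  obtain rfl : g = fun k => f k - c * f (k - 1) := funext hg
  set g : ℤ → R := fun k => f k - c * f (k - 1) with hgdef
  have hg_neg : ∀ k < 0, g k = 0 := fun k hk => by
    simp [hgdef, hf_neg k hk, hf_neg (k - 1) (by omega)]
  have hg_zero : g 0 = 1 := by simp [hgdef, hf_zero, hf_neg]
  let D : Matrix (Fin (n + 1 + 2)) (Fin (n + 1 + 2)) R := Matrix.of fun i j =>
    if (i : ℕ) < n + 2 then f (((n + 1 : ℕ) : ℤ) - 2 * ((i : ℕ) : ℤ) + ((j : ℕ) : ℤ))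
    else 1 * c ^ (j : ℕ)
  have hD : D.det = (-1) ^ (n + 2) * (stepTwoToeplitz g (n + 2 : ℕ) (n + 2)).det := by
    rw [det_of_geometric_last_row f c 1 _ (n + 2), mul_one]
    congr 2
  have hinner : D.submatrix (fun i : Fin (n + 1) => i.castSucc.succ) (fun i => i.castSucc.succ)
      = stepTwoToeplitz f n (n + 1) := by
    ext i j
    have := i.isLt
    simp only [D, Matrix.submatrix_apply, Matrix.of_apply, Fin.val_succ, Fin.val_castSucc,
      stepTwoToeplitz]
    rw [if_pos (by omega)]
    congr 1
    push_cast
    ring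
  have hcc : D.submatrix Fin.castSucc Fin.castSucc = stepTwoToeplitz f (n + 1 : ℕ) (n + 1 + 1) := by
    ext i j
    have := i.isLt
    simp only [D, Matrix.submatrix_apply, Matrix.of_apply, Fin.val_castSucc, stepTwoToeplitz]
    rw [if_pos (by omega)]
  have hcs : D.submatrix Fin.castSucc Fin.succ = stepTwoToeplitz f (n + 2 : ℕ) (n + 2) := by
    ext i j
    have := i.isLt
    simp only [D, Matrix.submatrix_apply, Matrix.of_apply, Fin.val_castSucc, Fin.val_succ,
      stepTwoToeplitz]
    rw [if_pos (by omega)]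
    congr 1
    push_cast
    ring
  have hsc : (D.submatrix Fin.succ Fin.castSucc).det
      = (-1) ^ (n + 1) * (stepTwoToeplitz g n (n + 1)).det := by
    have h := det_of_geometric_last_row f c 1 ((n : ℤ) - 1) (n + 1)
    rw [sub_add_cancel, mul_one] at h
    rw [← h]
    congr 1
    ext i j
    simp only [D, Matrix.submatrix_apply, Matrix.of_apply, Fin.val_castSucc, Fin.val_succ,
      show (i : ℕ) + 1 < n + 2 ↔ (i : ℕ) < n + 1 by omega]
    push_cast
    ring_nf
  have hss : (D.submatrix Fin.succ Fin.succ).det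
      = (-1) ^ (n + 1) * c * (stepTwoToeplitz g (n + 1 : ℕ) (n + 1)).det := by
    have h := det_of_geometric_last_row f c c (n : ℤ) (n + 1)
    push_cast
    rw [← h]
    congr 1
    ext i j
    simp only [D, Matrix.submatrix_apply, Matrix.of_apply, Fin.val_succ,
      show (i : ℕ) + 1 < n + 2 ↔ (i : ℕ) < n + 1 by omega]
    push_cast
    ring_nf
  have h := D.det_mul_det_submatrix_inner
  rw [hD, hinner, hcc, hcs, hsc, hss, det_stepTwoToeplitz_succ f hf_neg hf_zero,
    det_stepTwoToeplitz_succ f hf_neg hf_zero, det_stepTwoToeplitz_succ g hg_neg hg_zero] at h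
  have hs : ((-1 : R) ^ (n + 1)) * (-1) ^ (n + 1) = 1 := by
    rw [← mul_pow]
    simp
  rw [pow_succ (-1 : R) (n + 1)] at h
  linear_combination (-1 : R) ^ (n + 1) * h
    + (c * (stepTwoToeplitz f (n + 1 : ℕ) (n + 1)).det
        * (stepTwoToeplitz g (n + 1 : ℕ) (n + 1)).det
      - (stepTwoToeplitz f (n + 2 : ℕ) (n + 2)).det * (stepTwoToeplitz g n n).det
      + (stepTwoToeplitz g (n + 2 : ℕ) (n + 2)).det * (stepTwoToeplitz f n n).det) * hs

theorem phi_natCast {K : Type*} [Field K] (p : ℤ → K → K → K) (n : ℕ) (y z : K) :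
    phi p n y z = phiAux p n y z := by
  simp [phi]

theorem phi_neg_sub_one {K : Type*} [Field K] (p : ℤ → K → K → K) (n : ℕ) (y z : K) :
    phi p (-n - 1) y z = (-1) ^ (n * (n + 1) / 2) * phiAux p n y z := by
  have h : (-(n : ℤ) - 1) * (-n - 1 + 1) / 2 = ((n * (n + 1) / 2 : ℕ) : ℤ) := by
    push_cast
    congr 1
    ring
  rw [phi, if_neg (by omega), h, zpow_natCast]
  congr 2
  omega

theorem neg_one_pow_triangle_succ_succ {R : Type*} [CommRing R] (n : ℕ) :
    (-1 : R) ^ ((n + 2) * (n + 2 + 1) / 2) = -(-1) ^ (n * (n + 1) / 2) := by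
  have h : (n + 2) * (n + 2 + 1) / 2 = n * (n + 1) / 2 + 2 * (n + 1) + 1 := by
    rw [show (n + 2) * (n + 2 + 1) = n * (n + 1) + (2 * (n + 1) + 1) * 2 by ring,
      Nat.add_mul_div_right _ _ two_pos, add_assoc]
  rw [h, pow_succ, pow_add, pow_mul, neg_one_sq, one_pow]
  ring

theorem bilinear_bl6
    {K : Type*} [Field K] (q : K) (hq0 : q ≠ 0)
    (hq1 : ∀ k : ℕ, 1 ≤ k → q ^ k ≠ 1)
    (p : ℤ → K → K → K)
    (hp_neg : ∀ k : ℤ, k < 0 → ∀ y z : K, p k y z = 0)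
    (hp_zero : ∀ y z : K, p 0 y z = 1)
    (hC1 : ∀ k : ℕ, 1 ≤ k → ∀ y z : K,
      (∑ i ∈ Finset.range k, q ^ i) * p (k : ℤ) y z
        = (y + z + q ^ (k - 1)) * p ((k : ℤ) - 1) y z
          - (1 - q) * y * z * p ((k : ℤ) - 2) y z)
    (hC2 : ∀ (k : ℤ) (y z : K), p k y (q * z) - p k y z = (q - 1) * z * p (k - 1) y z)
    (hC3 : ∀ (k : ℤ) (y z : K), p k (q * y) z - p k y z = (q - 1) * y * p (k - 1) y z)
    (N : ℤ) (y z : K) :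
    phi p (N + 1) y (z / q) * phi p (N - 1) y z
      - phi p (N + 1) y z * phi p (N - 1) y (z / q)
    = (1 - q) * (z / q) * phi p N y (z / q) * phi p N y z := by
  have hcontig (k : ℤ) : p k y z = p k y (z / q) - (1 - q) * (z / q) * p (k - 1) y (z / q) := by
    have h := hC2 k y (z / q)
    rw [mul_div_cancel₀ z hq0] at h
    linear_combination h
  have hmain (n : ℕ) : phiAux p (n + 2) y (z / q) * phiAux p n y z
      - phiAux p (n + 2) y z * phiAux p n y (z / q)
      = (1 - q) * (z / q) * phiAux p (n + 1) y (z / q) * phiAux p (n + 1) y z :=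
    stepTwoToeplitz_bilinear (fun k => p k y (z / q)) (fun k => p k y z) _
      (fun k hk => hp_neg k hk _ _) (hp_zero _ _) hcontig n
  have hphiAux_zero (x : K) : phiAux p 0 y x = 1 := Matrix.det_fin_zero
  have hphiAux_one (x : K) : phiAux p 1 y x = p 1 y x := by simp [phiAux]
  have hone : p 1 y z = p 1 y (z / q) - (1 - q) * (z / q) := by
    have h := hcontig 1
    rwa [sub_self, hp_zero, mul_one] at h
  obtain ⟨n, rfl | rfl⟩ : ∃ n : ℕ, N = n ∨ N = -n - 1 := by
    rcases le_or_gt 0 N with h | h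
    · exact ⟨N.toNat, Or.inl (by omega)⟩
    · exact ⟨(-N - 1).toNat, Or.inr (by omega)⟩
  · cases n with
    | zero =>
      have h₁ (x : K) : phi p ((0 : ℕ) + 1) y x = p 1 y x := by
        rw [← hphiAux_one, ← phi_natCast]; rfl
      have h₂ (x : K) : phi p ((0 : ℕ) - 1) y x = 1 := by
        have h := phi_neg_sub_one p 0 y x
        simpa [hphiAux_zero] using h
      rw [h₁, h₁, h₂, h₂, phi_natCast, phi_natCast, hphiAux_zero, hphiAux_zero, hone]
      ring
    | succ n =>
      have h₁ : ((n + 1 : ℕ) : ℤ) + 1 = (n + 2 : ℕ) := by push_cast; ring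
      have h₂ : ((n + 1 : ℕ) : ℤ) - 1 = n := by push_cast; ring
      rw [h₁, h₂]
      simp only [phi_natCast]
      exact hmain n
  · cases n with
    | zero =>
      have h₁ (x : K) : phi p (-(0 : ℕ) - 1 + 1) y x = 1 := by
        rw [← hphiAux_zero x, ← phi_natCast]; rfl
      have h₂ (x : K) : phi p (-(0 : ℕ) - 1 - 1) y x = -p 1 y x := by
        have h := phi_neg_sub_one p 1 y x
        simpa [hphiAux_one] using h
      rw [h₁, h₁, h₂, h₂, phi_neg_sub_one, phi_neg_sub_one, hphiAux_zero, hphiAux_zero, hone]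
      simp
    | succ n =>
      have h₁ : -((n + 1 : ℕ) : ℤ) - 1 + 1 = -n - 1 := by push_cast; ring
      have h₂ : -((n + 1 : ℕ) : ℤ) - 1 - 1 = -(n + 2 : ℕ) - 1 := by push_cast; ring
      rw [h₁, h₂]
      simp only [phi_neg_sub_one, neg_one_pow_triangle_succ_succ]
      have hs (m : ℕ) : ((-1 : K) ^ m) * (-1) ^ m = 1 := by
        rw [← mul_pow]
        simp
      linear_combination hmain n
        + (phiAux p (n + 2) y (z / q) * phiAux p n y z
          - phiAux p (n + 2) y z * phiAux p n y (z / q)) * hs (n * (n + 1) / 2)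
        - (1 - q) * (z / q) * phiAux p (n + 1) y (z / q) * phiAux p (n + 1) y z
          * hs ((n + 1) * (n + 1 + 1) / 2)
end

section
/- (Difference Formula I, shifted first column.) Let N ≥ 1 be an integer and y, z ∈ K. Then: (a) the determinant of the N×N matrix whose column j = 0 has entries p_{N−2i}(y/q, z) (for 0 ≤ i ≤ N−1) and whose columns 1 ≤ j ≤ N−1 have entries p_{N−2i+j}(y, z) equals φ_N(y/q, z); (b) the determinant of the N×N matrix whose column j = 0 has entries p_{N−2i}(y, z/q) and whose columns 1 ≤ j ≤ N−1 have entries p_{N−2i+j}(y, z) equals φ_N(y, z/q). -/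
open Matrix Finset

/-- If `f (k) = g k + c * g (k - 1)`, then replacing `g` by `f` in all columns but the first of the
matrix `(g (n - 2i + j))` does not change its determinant. -/
theorem det_shift_eq_of_contiguous {K : Type*} [CommRing K] (n : ℕ) (f g : ℤ → K) (c : K)
    (h : ∀ k, f k = g k + c * g (k - 1)) :
    Matrix.det (Matrix.of fun i j : Fin n =>
      if (j : ℕ) = 0 then g ((n : ℤ) - 2 * ((i : ℕ) : ℤ))
      else f ((n : ℤ) - 2 * ((i : ℕ) : ℤ) + ((j : ℕ) : ℤ)))
    = Matrix.det (Matrix.of fun i j : Fin n =>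
      g ((n : ℤ) - 2 * ((i : ℕ) : ℤ) + ((j : ℕ) : ℤ))) := by
  cases n with
  | zero => simp
  | succ n =>
    symm
    refine Matrix.det_eq_of_forall_col_eq_smul_add_pred (fun _ => -c) (fun i => by simp)
      fun i j => ?_
    have hk : ((n + 1 : ℕ) : ℤ) - 2 * ((i : ℕ) : ℤ) + ((j.succ : ℕ) : ℤ) - 1
        = ((n + 1 : ℕ) : ℤ) - 2 * ((i : ℕ) : ℤ) + ((j.castSucc : ℕ) : ℤ) := by
      simp only [Fin.val_succ, Fin.val_castSucc]
      push_cast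
      ring
    simp only [Matrix.of_apply, h, hk]
    rw [if_neg (by simp)]
    ring

theorem difference_formula_I_shifted
    {K : Type*} [Field K] (q : K) (hq0 : q ≠ 0)
    (hq1 : ∀ k : ℕ, 1 ≤ k → q ^ k ≠ 1)
    (p : ℤ → K → K → K)
    (hp_neg : ∀ k : ℤ, k < 0 → ∀ y z : K, p k y z = 0)
    (hp_zero : ∀ y z : K, p 0 y z = 1)
    (hC1 : ∀ k : ℕ, 1 ≤ k → ∀ y z : K,
      (∑ i ∈ Finset.range k, q ^ i) * p (k : ℤ) y z
        = (y + z + q ^ (k - 1)) * p ((k : ℤ) - 1) y z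
          - (1 - q) * y * z * p ((k : ℤ) - 2) y z)
    (hC2 : ∀ (k : ℤ) (y z : K), p k y (q * z) - p k y z = (q - 1) * z * p (k - 1) y z)
    (hC3 : ∀ (k : ℤ) (y z : K), p k (q * y) z - p k y z = (q - 1) * y * p (k - 1) y z)
    (N : ℕ) (hN : 1 ≤ N) (y z : K) :
    Matrix.det (Matrix.of fun i j : Fin N =>
      if (j : ℕ) = 0 then p ((N : ℤ) - 2 * ((i : ℕ) : ℤ)) (y / q) z
      else p ((N : ℤ) - 2 * ((i : ℕ) : ℤ) + ((j : ℕ) : ℤ)) y z)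
    = phi p (N : ℤ) (y / q) z ∧
    Matrix.det (Matrix.of fun i j : Fin N =>
      if (j : ℕ) = 0 then p ((N : ℤ) - 2 * ((i : ℕ) : ℤ)) y (z / q)
      else p ((N : ℤ) - 2 * ((i : ℕ) : ℤ) + ((j : ℕ) : ℤ)) y z)
    = phi p (N : ℤ) y (z / q) := by
  have hphi : ∀ y z : K, phi p (N : ℤ) y z = phiAux p N y z := fun y z => by simp [phi]
  rw [hphi, hphi]
  constructor
  · refine det_shift_eq_of_contiguous N (fun k => p k y z) (fun k => p k (y / q) z)
      ((q - 1) * (y / q)) fun k => ?_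
    rw [← hC3, mul_div_cancel₀ y hq0]
    ring
  · refine det_shift_eq_of_contiguous N (fun k => p k y z) (fun k => p k y (z / q))
      ((q - 1) * (z / q)) fun k => ?_
    rw [← hC2, mul_div_cancel₀ z hq0]
    ring
end

section
/- (Difference Formula I, two shifted columns.) Let N ≥ 2 be an integer and y, z ∈ K. The determinant of the N×N matrix whose column j = 0 has entries p_{N+1−2i}(y, z/q) (for 0 ≤ i ≤ N−1), whose column j = 1 has entries p_{N+1−2i}(y/q, z), and whose columns 2 ≤ j ≤ N−1 have entries p_{N−2i+j}(y, z), equals ((1 − q)/q)·(z − y)·φ_N(y/q, z/q). -/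
open Matrix Finset

/-- A sum over `Fin n` against the indicator of the shifted diagonal `i + k = j`. -/
theorem sum_fin_mul_ite_add_eq {R : Type*} [Semiring R] {n : ℕ} (g : ℕ → R) (k : ℕ) (j : Fin n)
    (x : R) :
    ∑ i : Fin n, g i * (if (i : ℕ) + k = j then x else 0)
      = if k ≤ (j : ℕ) then g (j - k) * x else 0 := by
  rw [Fin.sum_univ_eq_sum_range (fun i => g i * (if i + k = (j : ℕ) then x else 0)) n]
  split_ifs with h
  · rw [Finset.sum_eq_single ((j : ℕ) - k)]
    · rw [if_pos (by omega)]
    · intro b _ hb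
      rw [if_neg (by omega), mul_zero]
    · intro hb
      exact absurd (Finset.mem_range.mpr (by omega)) hb
  · refine Finset.sum_eq_zero fun b _ => ?_
    rw [if_neg (by omega), mul_zero]

/-- The effect on a determinant of a column operation in which column `j` becomes `d j` times
itself plus multiples of columns `j - 1` and `j - 2`. -/
theorem det_three_term_column_operation {R : Type*} [CommRing R] {n : ℕ} (g : ℕ → ℕ → R)
    (d e f : ℕ → R) :
    Matrix.det (Matrix.of fun i j : Fin n =>
      g i j * d j + (if 1 ≤ (j : ℕ) then g i (j - 1) * e j else 0)
        + (if 2 ≤ (j : ℕ) then g i (j - 2) * f j else 0))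
      = Matrix.det (Matrix.of fun i j : Fin n => g i j) * ∏ j : Fin n, d j := by
  let U : Matrix (Fin n) (Fin n) R := Matrix.of fun i j =>
    (if (i : ℕ) + 0 = j then d j else 0) + (if (i : ℕ) + 1 = j then e j else 0)
      + (if (i : ℕ) + 2 = j then f j else 0)
  have hU : U.det = ∏ j : Fin n, d j := by
    rw [Matrix.det_of_isUpperTriangular]
    · exact Finset.prod_congr rfl fun j _ => by simp [U]
    · intro i j hij
      have hlt : (j : ℕ) < i := hij
      simp only [U, Matrix.of_apply]
      rw [if_neg (by omega), if_neg (by omega), if_neg (by omega)]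
      simp
  rw [← hU, ← Matrix.det_mul]
  congr 1
  ext i j
  simp only [U, Matrix.mul_apply, Matrix.of_apply, mul_add, Finset.sum_add_distrib,
    sum_fin_mul_ite_add_eq (g i)]
  simp

theorem difference_formula_I_two_columns
    {K : Type*} [Field K] (q : K) (hq0 : q ≠ 0)
    (hq1 : ∀ k : ℕ, 1 ≤ k → q ^ k ≠ 1)
    (p : ℤ → K → K → K)
    (hp_neg : ∀ k : ℤ, k < 0 → ∀ y z : K, p k y z = 0)
    (hp_zero : ∀ y z : K, p 0 y z = 1)
    (hC1 : ∀ k : ℕ, 1 ≤ k → ∀ y z : K,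
      (∑ i ∈ Finset.range k, q ^ i) * p (k : ℤ) y z
        = (y + z + q ^ (k - 1)) * p ((k : ℤ) - 1) y z
          - (1 - q) * y * z * p ((k : ℤ) - 2) y z)
    (hC2 : ∀ (k : ℤ) (y z : K), p k y (q * z) - p k y z = (q - 1) * z * p (k - 1) y z)
    (hC3 : ∀ (k : ℤ) (y z : K), p k (q * y) z - p k y z = (q - 1) * y * p (k - 1) y z)
    (N : ℕ) (hN : 2 ≤ N) (y z : K) :
    Matrix.det (Matrix.of fun i j : Fin N =>
      if (j : ℕ) = 0 then p ((N : ℤ) + 1 - 2 * ((i : ℕ) : ℤ)) y (z / q)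
      else if (j : ℕ) = 1 then p ((N : ℤ) + 1 - 2 * ((i : ℕ) : ℤ)) (y / q) z
      else p ((N : ℤ) - 2 * ((i : ℕ) : ℤ) + ((j : ℕ) : ℤ)) y z)
    = (1 - q) / q * (z - y) * phi p (N : ℤ) (y / q) (z / q) := by
  obtain ⟨Y, rfl⟩ : ∃ Y, y = q * Y := ⟨y / q, by field_simp⟩
  obtain ⟨Z, rfl⟩ : ∃ Z, z = q * Z := ⟨z / q, by field_simp⟩
  rw [mul_div_cancel_left₀ Y hq0, mul_div_cancel_left₀ Z hq0]
  have hA : ∀ k, p k (q * Y) Z = p k Y Z + (q - 1) * Y * p (k - 1) Y Z := fun k => by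
    linear_combination hC3 k Y Z
  have hB : ∀ k, p k Y (q * Z) = p k Y Z + (q - 1) * Z * p (k - 1) Y Z := fun k => by
    linear_combination hC2 k Y Z
  have hP : ∀ k, p k (q * Y) (q * Z) = p k Y Z + (q - 1) * (Y + Z) * p (k - 1) Y Z
      + (q - 1) ^ 2 * Y * Z * p (k - 2) Y Z := fun k => by
    have h := hA (k - 1)
    rw [show k - 1 - 1 = k - 2 by ring] at h
    linear_combination hC2 k (q * Y) Z + hA k + (q - 1) * Z * h
  have hcol := det_three_term_column_operation (n := N)
    (fun i j => p ((N : ℤ) - 2 * (i : ℤ) + (j : ℤ)) Y Z)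
    (fun j => if j = 0 then (q - 1) * (Y - Z) else 1)
    (fun j => if j = 1 then (q - 1) * Z else (q - 1) * (Y + Z))
    (fun _ => (q - 1) ^ 2 * Y * Z)
  have hprod : ∏ j : Fin N, (if (j : ℕ) = 0 then (q - 1) * (Y - Z) else 1)
      = (q - 1) * (Y - Z) := by
    rw [Fin.prod_univ_eq_prod_range (fun j => if j = 0 then (q - 1) * (Y - Z) else 1) N,
      Finset.prod_ite_eq' (Finset.range N) 0 fun _ => (q - 1) * (Y - Z),
      if_pos (Finset.mem_range.mpr (by omega))]
  rw [hprod] at hcol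
  have hphi : phi p (N : ℤ) Y Z = Matrix.det (Matrix.of fun i j : Fin N =>
      p ((N : ℤ) - 2 * ((i : ℕ) : ℤ) + ((j : ℕ) : ℤ)) Y Z) := by
    simp [phi, phiAux]
  have hc : (1 - q) / q * (q * Z - q * Y) = (q - 1) * (Y - Z) := by
    field_simp
    ring
  rw [hphi, hc, mul_comm ((q - 1) * (Y - Z)), ← hcol]
  have h01 : (⟨0, by omega⟩ : Fin N) ≠ ⟨1, by omega⟩ := by simp
  rw [← Matrix.det_updateCol_add_smul_self _ h01 (-1)]
  congr 1
  ext i ⟨j, hj⟩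
  rcases j with _ | _ | j
  · have h : (N : ℤ) + 1 - 2 * ((i : ℕ) : ℤ) - 1 = N - 2 * ((i : ℕ) : ℤ) := by ring
    simp [hA, hB, h]
    ring
  · have h : (N : ℤ) + 1 - 2 * ((i : ℕ) : ℤ) - 1 = N - 2 * ((i : ℕ) : ℤ) := by ring
    have h' : (N : ℤ) + 1 - 2 * ((i : ℕ) : ℤ) = N - 2 * ((i : ℕ) : ℤ) + 1 := by ring
    simp [hB, h]
    rw [h']
    ring
  · have h1 : (N : ℤ) - 2 * ((i : ℕ) : ℤ) + (j + 1 + 1) - 1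
        = N - 2 * ((i : ℕ) : ℤ) + (j + 1) := by ring
    have h2 : (N : ℤ) - 2 * ((i : ℕ) : ℤ) + (j + 1 + 1) - 2
        = N - 2 * ((i : ℕ) : ℤ) + j := by ring
    simp [hP, h1, h2]
    ring
end

section
/- (Casorati determinant form of φ_N.) Let N ≥ 1 be an integer and y, z ∈ K. Then the determinant of the N×N matrix whose (i,j) entry, for 0 ≤ i,j ≤ N−1, is p_{2N−1−2i}(y, q^{N−1−j}·z) equals ((q − 1)·z)^{N(N−1)/2} · q^{(N−2)(N−1)N/6} · φ_N(y, z). (The exponent (N−2)(N−1)N/6 is always a nonnegative integer.) -/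
open Matrix Finset

/-- The coefficients of the expansion of `f (q ^ m * z)` in iterated `q`-shifted differences at `z`,
where `a = (q - 1) * z`. -/
def shiftCoeff {R : Type*} [CommRing R] (q a : R) : ℕ → ℕ → R
  | 0, 0 => 1
  | 0, _ + 1 => 0
  | m + 1, 0 => shiftCoeff q a m 0
  | m + 1, k + 1 => shiftCoeff q a m (k + 1) + q ^ m * a * shiftCoeff q a m k

lemma shiftCoeff_eq_zero_of_lt {R : Type*} [CommRing R] (q a : R) {m k : ℕ} (h : m < k) :
    shiftCoeff q a m k = 0 := by
  induction m generalizing k with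
  | zero =>
    obtain ⟨k, rfl⟩ : ∃ l, k = l + 1 := ⟨k - 1, by omega⟩
    rw [shiftCoeff]
  | succ m ih =>
    obtain ⟨k, rfl⟩ : ∃ l, k = l + 1 := ⟨k - 1, by omega⟩
    rw [shiftCoeff, ih (by omega), ih (by omega)]
    ring

lemma shiftCoeff_self {R : Type*} [CommRing R] (q a : R) (m : ℕ) :
    shiftCoeff q a m m = a ^ m * q ^ m.choose 2 := by
  induction m with
  | zero => simp [shiftCoeff]
  | succ m ih =>
    rw [shiftCoeff, shiftCoeff_eq_zero_of_lt q a (Nat.lt_succ_self m), ih,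
      Nat.choose_succ_succ' m 1, Nat.choose_one_right]
    ring

/-- A family satisfying the contiguity relation in `z` is expanded along its index when `z` is
replaced by `q ^ m * z`. -/
lemma eval_pow_mul_eq_sum {R : Type*} [CommRing R] {q : R} {f : ℤ → R → R}
    (hf : ∀ (k : ℤ) (z : R), f k (q * z) - f k z = (q - 1) * z * f (k - 1) z)
    (z : R) {m n : ℕ} (hmn : m < n) (k : ℤ) :
    f k (q ^ m * z) = ∑ l ∈ Finset.range n, f (k - l) z * shiftCoeff q ((q - 1) * z) m l := by
  induction m generalizing n k with
  | zero =>
    obtain ⟨n, rfl⟩ : ∃ l, n = l + 1 := ⟨n - 1, by omega⟩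
    simp [Finset.sum_range_succ', shiftCoeff]
  | succ m ih =>
    obtain ⟨n, rfl⟩ : ∃ l, n = l + 1 := ⟨n - 1, by omega⟩
    have h := hf k (q ^ m * z)
    rw [← mul_assoc, ← pow_succ', sub_eq_iff_eq_add] at h
    rw [h, ih (show m < n + 1 by omega) k, ih (show m < n by omega) (k - 1),
      Finset.sum_range_succ', Finset.sum_range_succ', Finset.mul_sum, ← add_assoc,
      ← Finset.sum_add_distrib]
    congr 1
    refine Finset.sum_congr rfl fun l _ => ?_
    rw [shiftCoeff, show k - 1 - (l : ℤ) = k - ((l + 1 : ℕ) : ℤ) by push_cast; ring]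
    ring

lemma prod_shiftCoeff_self {R : Type*} [CommRing R] (q a : R) (n : ℕ) :
    ∏ m ∈ Finset.range n, shiftCoeff q a m m
      = a ^ (n * (n - 1) / 2) * q ^ ((n - 2) * (n - 1) * n / 6) := by
  have h3 : n.choose 3 = (n - 2) * (n - 1) * n / 6 := by
    rw [Nat.choose_eq_descFactorial_div_factorial]
    simp [Nat.descFactorial, Nat.factorial, mul_assoc]
  rw [← Nat.choose_two_right, ← h3]
  clear h3
  induction n with
  | zero => simp
  | succ n ih =>
    rw [Finset.prod_range_succ, ih, shiftCoeff_self, Nat.choose_succ_succ' n 1,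
      Nat.choose_succ_succ' n 2, Nat.choose_one_right]
    ring

theorem casorati_form
    {K : Type*} [Field K] (q : K) (hq0 : q ≠ 0)
    (hq1 : ∀ k : ℕ, 1 ≤ k → q ^ k ≠ 1)
    (p : ℤ → K → K → K)
    (hp_neg : ∀ k : ℤ, k < 0 → ∀ y z : K, p k y z = 0)
    (hp_zero : ∀ y z : K, p 0 y z = 1)
    (hC1 : ∀ k : ℕ, 1 ≤ k → ∀ y z : K,
      (∑ i ∈ Finset.range k, q ^ i) * p (k : ℤ) y z
        = (y + z + q ^ (k - 1)) * p ((k : ℤ) - 1) y z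
          - (1 - q) * y * z * p ((k : ℤ) - 2) y z)
    (hC2 : ∀ (k : ℤ) (y z : K), p k y (q * z) - p k y z = (q - 1) * z * p (k - 1) y z)
    (hC3 : ∀ (k : ℤ) (y z : K), p k (q * y) z - p k y z = (q - 1) * y * p (k - 1) y z)
    (N : ℕ) (hN : 1 ≤ N) (y z : K) :
    Matrix.det (Matrix.of fun i j : Fin N =>
      p (2 * (N : ℤ) - 1 - 2 * ((i : ℕ) : ℤ)) y (q ^ ((N : ℤ) - 1 - ((j : ℕ) : ℤ)) * z))
    = ((q - 1) * z) ^ (N * (N - 1) / 2) * q ^ ((N - 2) * (N - 1) * N / 6)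
        * phi p (N : ℤ) y z := by
  set a := (q - 1) * z with ha
  let C : Matrix (Fin N) (Fin N) K :=
    Matrix.of fun l j => shiftCoeff q a (N - 1 - j) (N - 1 - l)
  have hC : C.det = a ^ (N * (N - 1) / 2) * q ^ ((N - 2) * (N - 1) * N / 6) := by
    rw [Matrix.det_of_isLowerTriangular C fun i j hij =>
      shiftCoeff_eq_zero_of_lt q a (by have : (i : ℕ) < j := hij; omega)]
    rw [← prod_shiftCoeff_self, ← Finset.prod_range_reflect, Finset.prod_range]
    rfl
  have hphi : phi p (N : ℤ) y z = Matrix.det (Matrix.of fun i j : Fin N =>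
      p ((N : ℤ) - 2 * ((i : ℕ) : ℤ) + ((j : ℕ) : ℤ)) y z) := by
    simp [phi, phiAux]
  rw [hphi, ← hC, mul_comm C.det, ← Matrix.det_mul]
  congr 1
  ext i j
  have hj : q ^ ((N : ℤ) - 1 - ((j : ℕ) : ℤ)) = q ^ (N - 1 - (j : ℕ)) := by
    rw [← zpow_natCast]
    congr 1
    omega
  rw [Matrix.mul_apply, Matrix.of_apply, hj,
    eval_pow_mul_eq_sum (f := fun k w => p k y w) (fun k w => hC2 k y w) z
      (show N - 1 - (j : ℕ) < N by omega),
    ← Finset.sum_range_reflect, Finset.sum_range]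
  refine Finset.sum_congr rfl fun l _ => ?_
  simp only [C, Matrix.of_apply, ← ha]
  rw [show 2 * (N : ℤ) - 1 - 2 * ((i : ℕ) : ℤ) - ((N - 1 - (l : ℕ) : ℕ) : ℤ)
    = (N : ℤ) - 2 * ((i : ℕ) : ℤ) + ((l : ℕ) : ℤ) by omega]
end

section
/- (Difference Formula II.) Let N ≥ 1 be an integer and y, z ∈ K. Consider the N×N matrix whose (i,j) entry, for 0 ≤ i ≤ N−1 and 0 ≤ j ≤ N−2, is p_{2N−1−2i}(y, q^{N−1−j}·z), and whose last column (j = N−1) has entries q^{2N−1−2i}·p_{2N−1−2i}(y/q, z). Its determinant equals (−1)^{N−1} · (q − 1)^{N(N−1)/2} · z^{(N−1)(N−2)/2} · q^{N(N²+5)/6} · φ_N(y/q, z). (The exponent N(N²+5)/6 is always a nonnegative integer.) -/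
open Matrix Finset

/-- If `f` is a combination of the shifts `P (k - l)`, `l ≤ n`, then `f k + a * f (k - 1)` is a
combination of the shifts with `l ≤ n + 1`, whose top coefficient is multiplied by `a`. -/
lemma exists_shift_expansion_succ {K : Type*} [CommRing K] (P f : ℤ → K) (n : ℕ) (c : ℕ → K)
    (hf : ∀ k : ℤ, f k = ∑ l ∈ range (n + 1), c l * P (k - l)) (a : K) :
    ∃ c' : ℕ → K, c' (n + 1) = a * c n ∧
      ∀ k : ℤ, f k + a * f (k - 1) = ∑ l ∈ range (n + 2), c' l * P (k - l) := by
  refine ⟨fun l => (if l ≤ n then c l else 0) + a * (if l = 0 then 0 else c (l - 1)),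
    by simp, fun k => ?_⟩
  simp only [add_mul, sum_add_distrib]
  congr 1
  · rw [hf, sum_range_succ _ (n + 1)]
    simp only [Nat.not_succ_le_self, if_false, zero_mul, add_zero]
    refine sum_congr rfl fun l hl => ?_
    rw [if_pos (Nat.lt_succ_iff.mp (mem_range.mp hl))]
  · rw [hf, sum_range_succ' _ (n + 1), mul_sum]
    simp only [if_true, mul_zero, zero_mul, add_zero]
    refine sum_congr rfl fun l _ => ?_
    rw [if_neg l.succ_ne_zero, Nat.add_sub_cancel, mul_assoc]
    push_cast
    rw [sub_sub, add_comm (1 : ℤ)]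

/-- Iterating the `q`-shift in `z` expands `p_k(y, q^n z)` in terms of `p_{k-l}(y, z)`, `l ≤ n`. -/
lemma exists_qshift_expansion {K : Type*} [CommRing K] (q : K) (p : ℤ → K → K → K)
    (hC2 : ∀ (k : ℤ) (y z : K), p k y (q * z) - p k y z = (q - 1) * z * p (k - 1) y z)
    (y z : K) (n : ℕ) :
    ∃ c : ℕ → K, c n = (q - 1) ^ n * z ^ n * q ^ n.choose 2 ∧
      ∀ k : ℤ, p k y (q ^ n * z) = ∑ l ∈ range (n + 1), c l * p (k - l) y z := by
  induction n with
  | zero => exact ⟨fun _ => 1, by simp, fun k => by simp⟩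
  | succ n ih =>
    obtain ⟨c, hcn, hc⟩ := ih
    obtain ⟨c', hcn', hc'⟩ := exists_shift_expansion_succ (fun k => p k y z)
      (fun k => p k y (q ^ n * z)) n c hc ((q - 1) * (q ^ n * z))
    refine ⟨c', ?_, fun k => ?_⟩
    · rw [hcn', hcn, Nat.choose_succ_succ' n 1, Nat.choose_one_right]
      ring
    · rw [← hc' k, pow_succ', mul_assoc, ← hC2]
      ring

/-- The effect of a simultaneous `q`-shift in both variables. -/
lemma qshift_both {K : Type*} [Field K] (q : K) (hq0 : q ≠ 0) (p : ℤ → K → K → K)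
    (hp_neg : ∀ k : ℤ, k < 0 → ∀ y z : K, p k y z = 0)
    (hp_zero : ∀ y z : K, p 0 y z = 1)
    (hC1 : ∀ k : ℕ, 1 ≤ k → ∀ y z : K,
      (∑ i ∈ Finset.range k, q ^ i) * p (k : ℤ) y z
        = (y + z + q ^ (k - 1)) * p ((k : ℤ) - 1) y z
          - (1 - q) * y * z * p ((k : ℤ) - 2) y z)
    (hC2 : ∀ (k : ℤ) (y z : K), p k y (q * z) - p k y z = (q - 1) * z * p (k - 1) y z)
    (hC3 : ∀ (k : ℤ) (y z : K), p k (q * y) z - p k y z = (q - 1) * y * p (k - 1) y z)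
    (k : ℤ) (y z : K) :
    p k (q * y) (q * z) = q ^ k * (p k y z + (1 - q) * q⁻¹ * p (k - 1) y z) := by
  rcases lt_trichotomy k 0 with hk | rfl | hk
  · simp [hp_neg k hk, hp_neg (k - 1) (by omega)]
  · simp [hp_zero, hp_neg]
  · obtain ⟨n, rfl⟩ : ∃ n : ℕ, k = (n + 1 : ℕ) := ⟨k.toNat - 1, by omega⟩
    have h1 := hC1 (n + 1) (by omega) y z
    have hg := mul_geom_sum q (n + 1)
    have h2 := hC2 ((n + 1 : ℕ) : ℤ) (q * y) z
    have h3 := hC3 ((n + 1 : ℕ) : ℤ) y z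
    have h4 := hC3 (((n + 1 : ℕ) : ℤ) - 1) y z
    rw [sub_sub, one_add_one_eq_two] at h4
    rw [Nat.add_sub_cancel] at h1
    rw [zpow_natCast]
    have h5 : q ^ (n + 1) * q⁻¹ = q ^ n := by
      rw [pow_succ, mul_assoc, mul_inv_cancel₀ hq0, mul_one]
    linear_combination h2 + h3 + (q - 1) * z * h4 - (q - 1) * h1
      + p ((n + 1 : ℕ) : ℤ) y z * hg - (1 - q) * p (((n + 1 : ℕ) : ℤ) - 1) y z * h5

/-- The top coefficients of the column expansions of `difference_formula_II`. -/
noncomputable def topCoeff {K : Type*} [Field K] (q z : K) : ℕ → K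
  | 0 => 1
  | m + 1 => (1 - q) * q⁻¹ * ((q - 1) ^ m * z ^ m * q ^ m.choose 2)

lemma two_mul_choose_two_add (n : ℕ) : 2 * n.choose 2 + n = n ^ 2 := by
  induction n with
  | zero => rfl
  | succ n ih => rw [Nat.choose_succ_succ' n 1, Nat.choose_one_right]; linarith

lemma six_mul_choose_three_add (n : ℕ) : 6 * n.choose 3 + 3 * n ^ 2 = n ^ 3 + 2 * n := by
  induction n with
  | zero => rfl
  | succ n ih =>
    have := two_mul_choose_two_add n
    rw [Nat.choose_succ_succ' n 2]
    linarith

lemma prod_pow_mul_topCoeff {K : Type*} [Field K] (q : K) (hq0 : q ≠ 0) (z : K) (n : ℕ) :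
    ∏ m ∈ range (n + 1), q ^ (2 * m + 1) * topCoeff q z m =
      (-1 : K) ^ n * (q - 1) ^ (n + 1).choose 2 * z ^ n.choose 2
        * q ^ (n ^ 2 + n + 1 + n.choose 3) := by
  induction n with
  | zero => simp [topCoeff]
  | succ n ih =>
    rw [prod_range_succ, ih, topCoeff, Nat.choose_succ_succ' n 2, Nat.choose_succ_succ' (n + 1) 1,
      Nat.choose_succ_succ' n 1, Nat.choose_one_right, Nat.choose_one_right]
    have h : q ^ (2 * (n + 1) + 1) * q⁻¹ = q ^ (2 * (n + 1)) := by
      rw [pow_succ, mul_assoc, mul_inv_cancel₀ hq0, mul_one]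
    linear_combination ((-1 : K) ^ n * (q - 1) ^ (n + n.choose 2) * z ^ n.choose 2
        * q ^ (n ^ 2 + n + 1 + n.choose 3) * (1 - q)
        * ((q - 1) ^ n * z ^ n * q ^ n.choose 2)) * h

theorem difference_formula_II
    {K : Type*} [Field K] (q : K) (hq0 : q ≠ 0)
    (hq1 : ∀ k : ℕ, 1 ≤ k → q ^ k ≠ 1)
    (p : ℤ → K → K → K)
    (hp_neg : ∀ k : ℤ, k < 0 → ∀ y z : K, p k y z = 0)
    (hp_zero : ∀ y z : K, p 0 y z = 1)
    (hC1 : ∀ k : ℕ, 1 ≤ k → ∀ y z : K,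
      (∑ i ∈ Finset.range k, q ^ i) * p (k : ℤ) y z
        = (y + z + q ^ (k - 1)) * p ((k : ℤ) - 1) y z
          - (1 - q) * y * z * p ((k : ℤ) - 2) y z)
    (hC2 : ∀ (k : ℤ) (y z : K), p k y (q * z) - p k y z = (q - 1) * z * p (k - 1) y z)
    (hC3 : ∀ (k : ℤ) (y z : K), p k (q * y) z - p k y z = (q - 1) * y * p (k - 1) y z)
    (N : ℕ) (hN : 1 ≤ N) (y z : K) :
    Matrix.det (Matrix.of fun i j : Fin N =>
      if (j : ℕ) = N - 1 then
        q ^ (2 * (N : ℤ) - 1 - 2 * ((i : ℕ) : ℤ)) * p (2 * (N : ℤ) - 1 - 2 * ((i : ℕ) : ℤ)) (y / q) z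
      else p (2 * (N : ℤ) - 1 - 2 * ((i : ℕ) : ℤ)) y (q ^ ((N : ℤ) - 1 - ((j : ℕ) : ℤ)) * z))
    = (-1 : K) ^ (N - 1) * (q - 1) ^ (N * (N - 1) / 2) * z ^ ((N - 1) * (N - 2) / 2)
        * q ^ (N * (N ^ 2 + 5) / 6) * phi p (N : ℤ) (y / q) z := by
  set w := y / q with hw
  have hy : y = q * w := by rw [hw, mul_div_cancel₀ _ hq0]
  have hexp : ∀ m : ℕ, ∃ c : ℕ → K, c m = topCoeff q z m ∧ ∀ k : ℤ,
      (if m = 0 then q ^ k * p k w z else p k y (q ^ m * z))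
        = q ^ k * ∑ l ∈ range (m + 1), c l * p (k - l) w z := by
    rintro (_ | m)
    · exact ⟨fun _ => 1, by simp [topCoeff], fun k => by simp⟩
    · obtain ⟨c, hcm, hc⟩ := exists_qshift_expansion q p hC2 w z m
      obtain ⟨c', hcm', hc'⟩ := exists_shift_expansion_succ (fun k => p k w z)
        (fun k => p k w (q ^ m * z)) m c hc ((1 - q) * q⁻¹)
      refine ⟨c', by rw [hcm', hcm, topCoeff], fun k => ?_⟩
      rw [if_neg m.succ_ne_zero, ← hc' k, hy, pow_succ', mul_assoc,
        qshift_both q hq0 p hp_neg hp_zero hC1 hC2 hC3]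
  choose c hctop hc using hexp
  obtain ⟨n, rfl⟩ : ∃ n, N = n + 1 := ⟨N - 1, by omega⟩
  let T : Matrix (Fin (n + 1)) (Fin (n + 1)) K :=
    Matrix.of fun i j => if j ≤ i then c (n - j) (n - i) else 0
  let D : Fin (n + 1) → K := fun i => q ^ (2 * (n - (i : ℕ)) + 1)
  let A : Matrix (Fin (n + 1)) (Fin (n + 1)) K := Matrix.of fun i j =>
    p (((n + 1 : ℕ) : ℤ) - 2 * ((i : ℕ) : ℤ) + ((j : ℕ) : ℤ)) w z
  have hphi : phi p ((n + 1 : ℕ) : ℤ) w z = A.det := by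
    rw [phi, if_pos (Int.natCast_nonneg _), Int.toNat_natCast, phiAux]
  have hT : T.det = ∏ i : Fin (n + 1), topCoeff q z (n - i) := by
    rw [Matrix.det_of_isLowerTriangular T fun i j hij => if_neg (not_le.mpr hij)]
    simp [T, hctop]
  have hdet : (Matrix.diagonal D * (A * T)).det =
      (∏ m ∈ range (n + 1), q ^ (2 * m + 1) * topCoeff q z m) * A.det := by
    rw [Matrix.det_mul, Matrix.det_mul, Matrix.det_diagonal, hT,
      ← prod_range_reflect, ← Fin.prod_univ_eq_prod_range
        (fun i => q ^ (2 * (n + 1 - 1 - i) + 1) * topCoeff q z (n + 1 - 1 - i)),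
      prod_mul_distrib]
    simp only [D, Nat.add_sub_cancel]
    ring
  have hq_exp : (n + 1) * ((n + 1) ^ 2 + 5) / 6 = n ^ 2 + n + 1 + n.choose 3 := by
    have := six_mul_choose_three_add n
    apply Nat.div_eq_of_eq_mul_right (by norm_num)
    linarith
  rw [hphi, hq_exp, ← Nat.choose_two_right, Nat.add_sub_cancel,
    show n + 1 - 2 = n - 1 by omega, ← Nat.choose_two_right,
    ← prod_pow_mul_topCoeff q hq0, ← hdet]
  congr 1
  ext i j
  have hi := i.isLt
  have hj := j.isLt
  rw [Matrix.diagonal_mul, Matrix.mul_apply]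
  simp only [Matrix.of_apply, D, A, T]
  have hk : 2 * ((n + 1 : ℕ) : ℤ) - 1 - 2 * ((i : ℕ) : ℤ) = ((2 * (n - (i : ℕ)) + 1 : ℕ) : ℤ) := by
    omega
  have hm : ((n + 1 : ℕ) : ℤ) - 1 - ((j : ℕ) : ℤ) = ((n - (j : ℕ) : ℕ) : ℤ) := by omega
  have hcol := hc (n - j) ((2 * (n - (i : ℕ)) + 1 : ℕ) : ℤ)
  rw [hk, hm, zpow_natCast, zpow_natCast]
  rw [zpow_natCast] at hcol
  have hif : ((j : ℕ) = n) ↔ n - (j : ℕ) = 0 := by omega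
  simp only [hif]
  rw [hcol]
  congr 1
  simp only [Fin.le_def]
  let g : ℕ → K := fun s => p (((n + 1 : ℕ) : ℤ) - 2 * ((i : ℕ) : ℤ) + (s : ℤ)) w z *
    (if (j : ℕ) ≤ s then c (n - j) (n - s) else 0)
  rw [Fin.sum_univ_eq_sum_range g, ← sum_range_reflect g]
  have hsub : range (n - (j : ℕ) + 1) ⊆ range (n + 1) := range_subset_range.mpr (by omega)
  rw [← sum_subset hsub]
  · refine sum_congr rfl fun l hl => ?_
    rw [mem_range] at hl
    simp only [g]
    rw [if_pos (by omega), mul_comm, show n - (n + 1 - 1 - l) = l by omega]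
    congr 2
    omega
  · intro l hl hl'
    rw [mem_range] at hl hl'
    simp only [g]
    rw [if_neg (by omega), mul_zero]
end
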